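/- arXiv:2206.01091 — 2 statements merged into one kernel-verified Lean document; each statement's English description precedes it below -/
import Mathlib

section
/- Let V and W be finite-dimensional vector spaces and f : V → V, g : W → W linear maps. Then for each j, the trace of the j-th exterior power of f ⊗ g : V ⊗ W → V ⊗ W satisfies tr Λ^j(f ⊗ g) = Σ_{|λ|=j} tr ρ_{λ'}(g) · tr ρ_λ(f), where the sum is over partitions λ of j with at most dim V rows and at most dim W columns, λ' is the conjugate partition, and ρ_λ denotes the Schur functor. Equivalently, Λ^j(V ⊗ W) ≅ ⊕_{|λ|=j} S_λ(V) ⊗ S_{λ'}(W) as GL(V) × GL(W)-representations. -/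
open Matrix Polynomial

noncomputable section

/-- The trace of the `j`-th exterior power of a square matrix `M`, i.e. the sum of
its principal `j × j` minors. -/
def traceExteriorPower {ι : Type*} [Fintype ι] [DecidableEq ι] {K : Type*} [Field K]
    (j : ℕ) (M : Matrix ι ι K) : K :=
  ∑ s ∈ Finset.univ.filter (fun s : Finset ι => s.card = j),
    (M.submatrix (fun i : {i // i ∈ s} => (i : ι)) (fun i : {i // i ∈ s} => (i : ι))).det

/-- Complete homogeneous symmetric function `h_m` in `N` variables. -/
def hSym {R : Type*} [CommRing R] (N m : ℕ) (x : Fin N → R) : R :=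
  ∑ s : Sym (Fin N) m, (s.1.map x).prod

def hSymZ {R : Type*} [CommRing R] (N : ℕ) (x : Fin N → R) (d : ℤ) : R :=
  if 0 ≤ d then hSym N d.toNat x else 0

/-- Schur polynomial, via the Jacobi–Trudi formula, of a partition given as its
list of parts in decreasing order.  `schurFn N l x` is the trace of the Schur
functor `S_l` applied to an endomorphism with eigenvalues `x`. -/
def schurFn {R : Type*} [CommRing R] (N : ℕ) (l : List ℕ) (x : Fin N → R) : R :=
  Matrix.det (Matrix.of fun i j : Fin l.length =>
    hSymZ N x ((l.get i : ℤ) + (j : ℤ) - (i : ℤ)))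

/-- Conjugate partition of a partition given as a list of parts. -/
def conjList (l : List ℕ) : List ℕ :=
  (List.range (l.foldr max 0)).map fun i => (l.filter (fun a => i < a)).length

/-- The parts of a partition, as a decreasingly sorted list. -/
def partsList {j : ℕ} (μ : Nat.Partition j) : List ℕ :=
  (μ.parts.sort (· ≤ ·)).reverse

theorem reverse_prod_X_sub_C {K ι : Type*} [Field K] (s : Finset ι) (a : ι → K) :
    (∏ i ∈ s, (X - C (a i))).reverse = ∏ i ∈ s, (1 - C (a i) * X) := by
  classical
  induction s using Finset.induction_on with
  | empty => simpa using reverse_C (1 : K)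
  | insert i s hi ih =>
    have h : (X - C (a i)).reverse = 1 - C (a i) * X := by
      rw [reverse, natDegree_X_sub_C, sub_eq_add_neg, ← C_neg, reflect_add, reflect_C,
        ← pow_one (X : K[X]), reflect_monomial]
      simp [sub_eq_add_neg, revAt_le le_rfl]
    rw [Finset.prod_insert hi, Finset.prod_insert hi, reverse_mul_of_domain, ih, h]

theorem charpolyRev_kronecker {K : Type*} [Field K] {n m : ℕ}
    (F : Matrix (Fin n) (Fin n) K) (G : Matrix (Fin m) (Fin m) K)
    (x : Fin n → K) (y : Fin m → K)
    (hF : F.charpoly = ∏ i, (X - C (x i))) (hG : G.charpoly = ∏ i, (X - C (y i))) :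
    (Matrix.kroneckerMap (· * ·) F G).charpolyRev = ∏ i, ∏ k, (1 - C (x i * y k) * X) := by
  have hF' : F.charpolyRev = ∏ i, (1 - C (x i) * X) := by
    rw [← reverse_charpoly, hF, reverse_prod_X_sub_C]
  have hG' : G.charpolyRev = ∏ i, (1 - C (y i) * X) := by
    rw [← reverse_charpoly, hG, reverse_prod_X_sub_C]
  let f : K[X] →+* Matrix (Fin m) (Fin m) K[X] :=
    (aeval ((X : K[X]) • G.map C) : K[X] →ₐ[K] Matrix (Fin m) (Fin m) K[X]).toRingHom
  have hfC (a : K) (p : K[X]) : f (C a * p) = C a • f p := by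
    rw [← smul_eq_C_mul, ← algebraMap_eq, algebraMap_smul]
    exact map_smul (aeval ((X : K[X]) • G.map C)) a p
  have hfX : f X = (X : K[X]) • G.map C := by simp [f]
  have hdd := Matrix.det_det (m := Fin n) (1 - (X : K[X]) • F.map C) f
  rw [show (1 - (X : K[X]) • F.map C).det = ∏ i, (1 - C (x i) * X) from hF'] at hdd
  have hL (i : Fin n) : (f (1 - C (x i) * X)).det = ∏ k, (1 - C (x i * y k) * X) := by
    have h := congrArg (Polynomial.compRingHom (C (x i) * X)) hG'
    rw [charpolyRev, RingHom.map_det, map_prod] at h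
    convert h using 2
    · rw [map_sub, hfC, hfX, map_one]
      ext1 a b
      simp [Matrix.one_apply]
      split_ifs <;> simp <;> ring
    · simp; ring
  have hprod : (f (∏ i, (1 - C (x i) * X))).det = ∏ i, (f (1 - C (x i) * X)).det :=
    map_prod (Matrix.detMonoidHom.comp f.toMonoidHom) _ _
  rw [← Finset.prod_congr rfl fun i _ => hL i, ← hprod, hdd, charpolyRev]
  congr 1
  ext1 ⟨a, b⟩ ⟨c, d⟩
  simp only [Matrix.comp_apply, Matrix.map_apply, Matrix.sub_apply, Matrix.smul_apply,
    smul_eq_mul, map_sub, mul_comm X (C _), hfC, hfX, Matrix.kroneckerMap_apply]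
  by_cases h : a = c
  · subst h
    by_cases h' : b = d <;> simp [Matrix.one_apply, h'] <;> ring
  · simp [h]; ring

theorem traceExteriorPower_eq_coeff {ι K : Type*} [Fintype ι] [DecidableEq ι] [Field K]
    (j : ℕ) (M : Matrix ι ι K) :
    traceExteriorPower j M = (-1) ^ j * M.charpolyRev.coeff j := by
  have h : M.charpolyRev = det (1 + (X : K[X]) • (-M).map C) := by
    simp only [charpolyRev, sub_eq_add_neg]
    congr 2
    rw [Matrix.map_neg C (map_neg C) M, smul_neg]
  rw [h, coeff_det_one_add_X_smul_eq_sum_minors, Finset.mul_sum, traceExteriorPower]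
  refine Finset.sum_congr (by ext; simp [Finset.mem_powersetCard]) fun s hs => ?_
  rw [submatrix_neg, Pi.neg_apply, Pi.neg_apply, det_neg, Fintype.card_coe,
    (Finset.mem_powersetCard.mp hs).2, ← mul_assoc, ← mul_pow]
  simp

theorem mk_hSym {R : Type*} [CommRing R] (N : ℕ) (x : Fin N → R) :
    PowerSeries.mk (fun d => hSym N d x) = ∏ i, PowerSeries.mk (fun d => x i ^ d) := by
  ext d
  rw [PowerSeries.coeff_mk, PowerSeries.coeff_prod, hSym]
  simp only [PowerSeries.coeff_mk]
  refine Finset.sum_bij (fun s _ => Multiset.toFinsupp s.1) ?_ ?_ ?_ ?_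
  · intro s _
    rw [Finset.mem_finsuppAntidiag]
    refine ⟨?_, Finset.subset_univ _⟩
    exact (Multiset.sum_count_eq_card fun a _ => Finset.mem_univ a).trans s.2
  · intro s _ t _ h
    exact Subtype.ext (Multiset.toFinsupp.injective h)
  · intro l hl
    rw [Finset.mem_finsuppAntidiag] at hl
    refine ⟨⟨Finsupp.toMultiset l, ?_⟩, Finset.mem_univ _, by simp⟩
    rw [Finsupp.card_toMultiset, ← hl.1, Finsupp.sum_fintype _ _ (by simp)]
    simp
  · intro s _
    rw [Finset.prod_multiset_map_count]
    refine Finset.prod_subset (Finset.subset_univ _) fun i _ hi => ?_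
    rw [Multiset.count_eq_zero_of_notMem (by simpa using hi), pow_zero]

theorem mk_pow_mul_one_sub {R : Type*} [CommRing R] (a : R) :
    (PowerSeries.mk (fun d => a ^ d)) * ((1 - C a * X : R[X]) : PowerSeries R) = 1 := by
  ext d
  rw [Polynomial.coe_sub, Polynomial.coe_mul, Polynomial.coe_C, Polynomial.coe_X,
    Polynomial.coe_one, mul_sub, mul_one, map_sub, mul_left_comm, ← PowerSeries.smul_eq_C_mul,
    map_smul]
  cases d with
  | zero => simp
  | succ d => simp [PowerSeries.coeff_succ_mul_X, PowerSeries.coeff_one, pow_succ']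

/-- `∏_{l ≠ k} (1 - x_l X)`. -/
def deletedProd {R : Type*} [CommRing R] {N : ℕ} (x : Fin N → R) (k : Fin N) : R[X] :=
  ∏ l ∈ Finset.univ.erase k, (1 - C (x l) * X)

theorem natDegree_deletedProd_lt {R : Type*} [CommRing R] {N : ℕ} (x : Fin N → R) (k : Fin N) :
    (deletedProd x k).natDegree < N := by
  have h : (deletedProd x k).natDegree ≤ ∑ l ∈ Finset.univ.erase k, 1 := by
    refine (natDegree_prod_le _ _).trans (Finset.sum_le_sum fun l _ => ?_)
    compute_degree
  have := k.pos
  simp at h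
  omega

theorem pow_eq_sum_deletedProd_coeff {R : Type*} [CommRing R] {N : ℕ} (x : Fin N → R)
    (k : Fin N) (c : ℕ) :
    x k ^ c = ∑ b : Fin N, (deletedProd x k).coeff b * hSymZ N x ((c : ℤ) - b) := by
  have h : (deletedProd x k : PowerSeries R) * PowerSeries.mk (fun d => hSym N d x)
      = PowerSeries.mk (fun d => x k ^ d) := by
    rw [mk_hSym, ← Finset.mul_prod_erase _ _ (Finset.mem_univ k), deletedProd,
      ← Polynomial.coeToPowerSeries.ringHom_apply, map_prod, mul_left_comm,
      ← Finset.prod_mul_distrib]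
    convert mul_one _
    exact Finset.prod_eq_one fun l _ => by
      rw [Polynomial.coeToPowerSeries.ringHom_apply, mul_comm, mk_pow_mul_one_sub]
  have h := congrArg (PowerSeries.coeff c) h
  rw [PowerSeries.coeff_mk, PowerSeries.coeff_mul,
    Finset.Nat.sum_antidiagonal_eq_sum_range_succ_mk] at h
  simp only [Polynomial.coeff_coe, PowerSeries.coeff_mk] at h
  rw [← h, Fin.sum_univ_eq_sum_range
    (fun b => (deletedProd x k).coeff b * hSymZ N x ((c : ℤ) - b)) N]
  have hterm (b : ℕ) : (deletedProd x k).coeff b * hSymZ N x ((c : ℤ) - b)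
      = if b ≤ c then (deletedProd x k).coeff b * hSym N (c - b) x else 0 := by
    unfold hSymZ
    split_ifs with h1 h2 h2
    · congr; omega
    · omega
    · omega
    · simp
  rw [Finset.sum_congr rfl fun b _ => hterm b, ← Finset.sum_filter,
    ← Finset.sum_subset (s₁ := Finset.range N ∩ Finset.range (c + 1)) Finset.inter_subset_right]
  · exact Finset.sum_congr (by ext; simp) fun _ _ => rfl
  · intro b hb hb'
    have : (deletedProd x k).natDegree < b := by
      have := natDegree_deletedProd_lt x k
      simp at hb hb'
      by_contra hlt
      have := hb' (by omega)
      omega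
    simp [coeff_eq_zero_of_natDegree_lt this]

theorem hSymZ_of_neg {R : Type*} [CommRing R] {N : ℕ} (x : Fin N → R) {d : ℤ} (hd : d < 0) :
    hSymZ N x d = 0 := if_neg (by omega)

theorem hSymZ_zero {R : Type*} [CommRing R] {N : ℕ} (x : Fin N → R) : hSymZ N x 0 = 1 := by
  rw [hSymZ, if_pos le_rfl]
  exact (Fintype.sum_unique (ι := Sym (Fin N) 0) _).trans (Multiset.prod_zero)

/-- The matrix whose `n` upper rows are shifts of `h(x)` and whose `m` lower rows are reversed
shifts of `h(y)`. -/
def stackedMatrix {R : Type*} [CommRing R] {n m : ℕ} (x : Fin n → R) (y : Fin m → R) :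
    Matrix (Fin n ⊕ Fin m) (Fin (n + m)) R :=
  Matrix.of fun r c => Sum.elim (fun b : Fin n => hSymZ n x ((c : ℤ) - (b : ℤ)))
    (fun b : Fin m => hSymZ m y ((n : ℤ) + (b : ℤ) - (c : ℤ))) r

theorem prod_Ioi_fin_add {M : Type*} [CommMonoid M] {n m : ℕ}
    (f : Fin (n + m) → Fin (n + m) → M) :
    ∏ i, ∏ j ∈ Finset.Ioi i, f i j =
      (∏ i : Fin n, ∏ j ∈ Finset.Ioi i, f (Fin.castAdd m i) (Fin.castAdd m j)) *
      (∏ i : Fin n, ∏ k : Fin m, f (Fin.castAdd m i) (Fin.natAdd n k)) *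
      (∏ k : Fin m, ∏ l ∈ Finset.Ioi k, f (Fin.natAdd n k) (Fin.natAdd n l)) := by
  have h (N : ℕ) (i : Fin N) : Finset.Ioi i = Finset.univ.filter (i < ·) := by ext; simp
  simp only [h, Finset.prod_filter]
  rw [Fin.prod_univ_add, ← Finset.prod_mul_distrib]
  congr 1
  · refine Finset.prod_congr rfl fun i _ => ?_
    rw [Fin.prod_univ_add]
    congr 1
    refine Finset.prod_congr rfl fun k _ => if_pos ?_
    rw [Fin.lt_def]; simp; omega
  · refine Finset.prod_congr rfl fun i _ => ?_
    rw [Fin.prod_univ_add]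
    rw [Finset.prod_eq_one, one_mul]
    · simp
    · intro k _
      exact if_neg (by rw [Fin.lt_def]; simp; omega)

theorem det_hSymZ_sub_eq_one {R : Type*} [CommRing R] {N M : ℕ} (x : Fin N → R) :
    (Matrix.of fun b c : Fin M => hSymZ N x ((c : ℤ) - b)).det = 1 := by
  rw [Matrix.det_of_isUpperTriangular]
  · simp [hSymZ_zero]
  · intro i j hij
    have : (j : ℕ) < i := hij
    exact hSymZ_of_neg _ (by omega)

theorem det_deletedProd_coeff {R : Type*} [CommRing R] {N : ℕ} (x : Fin N → R) :
    (Matrix.of fun k b : Fin N => (deletedProd x k).coeff b).det =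
      ∏ i, ∏ j ∈ Finset.Ioi i, (x j - x i) := by
  rw [← Matrix.det_vandermonde]
  have h : Matrix.vandermonde x = (Matrix.of fun k b : Fin N => (deletedProd x k).coeff b) *
      (Matrix.of fun b c : Fin N => hSymZ N x ((c : ℤ) - b)) := by
    ext k c
    simp [Matrix.vandermonde_apply, Matrix.mul_apply, pow_eq_sum_deletedProd_coeff x k c]
  rw [h, Matrix.det_mul, det_hSymZ_sub_eq_one, mul_one]

theorem det_deletedProd_coeff_rev {R : Type*} [CommRing R] {N : ℕ} (y : Fin N → R) :
    (Matrix.of fun k b : Fin N => (deletedProd y k).coeff b.rev).det =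
      ∏ i, ∏ j ∈ Finset.Ioi i, (y i - y j) := by
  have h : Matrix.projVandermonde 1 y =
      (Matrix.of fun k b : Fin N => (deletedProd y k).coeff b.rev) *
      (Matrix.of fun b c : Fin N => hSymZ N y ((b : ℤ) - c)) := by
    ext k c
    rw [Matrix.projVandermonde_apply, Matrix.mul_apply, ← Equiv.sum_comp Fin.revPerm]
    simp only [Pi.one_apply, one_pow, one_mul, Matrix.of_apply, Fin.revPerm_apply, Fin.rev_rev]
    rw [pow_eq_sum_deletedProd_coeff]
    refine Finset.sum_congr rfl fun b _ => ?_
    congr 2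
    simp only [Fin.val_rev]
    omega
  have h' := congrArg Matrix.det h
  rw [Matrix.det_projVandermonde, Matrix.det_mul,
    ← Matrix.det_transpose (Matrix.of fun b c : Fin N => hSymZ N y ((b : ℤ) - c))] at h'
  have h1 := det_hSymZ_sub_eq_one (M := N) y
  simpa [Matrix.transpose, h1] using h'.symm

theorem det_stackedMatrix_of_injective {R : Type*} [CommRing R] [IsDomain R] {n m : ℕ}
    {x : Fin n → R} {y : Fin m → R} (hx : Function.Injective x) (hy : Function.Injective y) :
    ((stackedMatrix x y).submatrix id finSumFinEquiv).det = ∏ i, ∏ k, (1 - x i * y k) := by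
  set A : Matrix (Fin n) (Fin n) R := Matrix.of fun k b => (deletedProd x k).coeff b with hA
  set B : Matrix (Fin m) (Fin m) R := Matrix.of fun k b => (deletedProd y k).coeff b.rev with hB
  have h : Matrix.fromBlocks A 0 0 B * (stackedMatrix x y).submatrix id finSumFinEquiv =
      (Matrix.projVandermonde (Sum.elim x 1 ∘ finSumFinEquiv.symm)
        (Sum.elim 1 y ∘ finSumFinEquiv.symm)).submatrix finSumFinEquiv finSumFinEquiv := by
    ext r s
    generalize hc : finSumFinEquiv s = c
    simp only [Matrix.mul_apply, Fintype.sum_sum_type, Matrix.submatrix_apply, hc,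
      Matrix.projVandermonde_apply, Function.comp_apply, Equiv.symm_apply_apply, stackedMatrix,
      id_eq, Matrix.of_apply]
    cases r with
    | inl k => simp [hA, pow_eq_sum_deletedProd_coeff]
    | inr k =>
      simp only [Matrix.fromBlocks_apply₂₁, Matrix.zero_apply, zero_mul, Finset.sum_const_zero,
        zero_add, Matrix.fromBlocks_apply₂₂, Sum.elim_inr, Pi.one_apply, one_pow, one_mul, hB,
        Matrix.of_apply]
      rw [← Equiv.sum_comp Fin.revPerm, pow_eq_sum_deletedProd_coeff]
      refine Finset.sum_congr rfl fun b _ => ?_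
      simp only [Fin.revPerm_apply, Fin.rev_rev]
      congr 2
      simp only [Fin.val_rev]
      omega
  have h' := congrArg Matrix.det h
  rw [Matrix.det_mul, Matrix.det_fromBlocks_zero₂₁, Matrix.det_submatrix_equiv_self,
    Matrix.det_projVandermonde, hA, hB, det_deletedProd_coeff, det_deletedProd_coeff_rev,
    prod_Ioi_fin_add] at h'
  simp only [Function.comp_apply, finSumFinEquiv_symm_apply_castAdd,
    finSumFinEquiv_symm_apply_natAdd, Sum.elim_inl, Sum.elim_inr, Pi.one_apply, mul_one,
    one_mul] at h'
  have hx0 : ∏ i, ∏ j ∈ Finset.Ioi i, (x j - x i) ≠ 0 :=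
    Finset.prod_ne_zero_iff.2 fun i _ => Finset.prod_ne_zero_iff.2 fun j hj =>
      sub_ne_zero.2 fun h => (Finset.mem_Ioi.1 hj).ne' (hx h)
  have hy0 : ∏ i, ∏ j ∈ Finset.Ioi i, (y i - y j) ≠ 0 :=
    Finset.prod_ne_zero_iff.2 fun i _ => Finset.prod_ne_zero_iff.2 fun j hj =>
      sub_ne_zero.2 fun h => (Finset.mem_Ioi.1 hj).ne (hy h)
  refine mul_left_cancel₀ (mul_ne_zero hx0 hy0) (h'.trans ?_)
  ring

theorem map_hSymZ {R S : Type*} [CommRing R] [CommRing S] (f : R →+* S) {N : ℕ} (x : Fin N → R)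
    (d : ℤ) : f (hSymZ N x d) = hSymZ N (f ∘ x) d := by
  unfold hSymZ hSym
  split_ifs
  · simp [map_multiset_prod]
  · simp

theorem det_stackedMatrix {R : Type*} [CommRing R] {n m : ℕ} (x : Fin n → R) (y : Fin m → R) :
    ((stackedMatrix x y).submatrix id finSumFinEquiv).det = ∏ i, ∏ k, (1 - x i * y k) := by
  let P := MvPolynomial (Fin n ⊕ Fin m) ℤ
  let u : Fin n → P := fun i => MvPolynomial.X (Sum.inl i)
  let v : Fin m → P := fun k => MvPolynomial.X (Sum.inr k)
  have hu : Function.Injective u := fun i j h => Sum.inl_injective (MvPolynomial.X_injective h)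
  have hv : Function.Injective v := fun i j h => Sum.inr_injective (MvPolynomial.X_injective h)
  let f : P →+* R := MvPolynomial.eval₂Hom (Int.castRingHom R) (Sum.elim x y)
  have hfu : f ∘ u = x := by ext; exact MvPolynomial.eval₂_X _ _ _
  have hfv : f ∘ v = y := by ext; exact MvPolynomial.eval₂_X _ _ _
  have h := congrArg f (det_stackedMatrix_of_injective hu hv)
  rw [RingHom.map_det] at h
  convert h using 2
  · ext r c
    rcases r with b | b <;> simp [stackedMatrix, map_hSymZ, hfu, hfv]
  · simp [← hfu, ← hfv]

/-- Generalized Laplace expansion: the determinant is a signed sum of products of complementary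
minors, over a system of representatives `τ` of the ways to split the columns. -/
theorem det_eq_sum_complementary_minors {R ι κ α Λ : Type*} [CommRing R] [Fintype ι] [Fintype κ]
    [DecidableEq ι] [DecidableEq κ] [Fintype Λ] (τ : Λ → (ι ⊕ κ ≃ α))
    (hτ : ∀ σ : ι ⊕ κ ≃ α, ∃! l, Set.range (σ ∘ Sum.inl) = Set.range (τ l ∘ Sum.inl))
    (Z : Matrix (ι ⊕ κ) α R) (e : ι ⊕ κ ≃ α) :
    (Z.submatrix id e).det = ∑ l, ((Equiv.Perm.sign ((τ l).trans e.symm) : ℤ) : R) *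
      ((Z.submatrix Sum.inl (τ l ∘ Sum.inl)).det * (Z.submatrix Sum.inr (τ l ∘ Sum.inr)).det) := by
  have hterm (l : Λ) : ((Equiv.Perm.sign ((τ l).trans e.symm) : ℤ) : R) *
      ((Z.submatrix Sum.inl (τ l ∘ Sum.inl)).det * (Z.submatrix Sum.inr (τ l ∘ Sum.inr)).det) =
      ∑ p : Equiv.Perm ι × Equiv.Perm κ,
        ((Equiv.Perm.sign (((Equiv.sumCongr p.1 p.2).trans (τ l)).trans e.symm) : ℤ) : R) *
          ∏ r, Z r (τ l (Equiv.sumCongr p.1 p.2 r)) := by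
    rw [← Matrix.det_transpose (Z.submatrix Sum.inl _),
      ← Matrix.det_transpose (Z.submatrix Sum.inr _), Matrix.det_apply', Matrix.det_apply',
      Finset.sum_mul_sum, ← Finset.sum_product', Finset.mul_sum]
    refine Finset.sum_congr rfl fun p _ => ?_
    have hs : Equiv.Perm.sign (((Equiv.sumCongr p.1 p.2).trans (τ l)).trans e.symm) =
        Equiv.Perm.sign ((τ l).trans e.symm) * (Equiv.Perm.sign p.1 * Equiv.Perm.sign p.2) := by
      rw [← Equiv.Perm.sign_sumCongr, ← Equiv.Perm.sign_mul]
      rfl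
    rw [hs, Fintype.prod_sum_type]
    simp only [Matrix.transpose_apply, Matrix.submatrix_apply, Function.comp_apply,
      Equiv.sumCongr_apply, Sum.map_inl, Sum.map_inr]
    push_cast
    ring
  rw [Finset.sum_congr rfl fun l _ => hterm l, Finset.sum_sigma',
    ← Matrix.det_transpose, Matrix.det_apply']
  have hrange (l : Λ) (p : Equiv.Perm ι × Equiv.Perm κ) :
      Set.range (((Equiv.sumCongr p.1 p.2).trans (τ l)) ∘ Sum.inl) =
        Set.range (τ l ∘ Sum.inl) := by
    ext c
    constructor
    · rintro ⟨i, rfl⟩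
      exact ⟨p.1 i, rfl⟩
    · rintro ⟨i, rfl⟩
      exact ⟨p.1.symm i, by simp⟩
  symm
  refine Finset.sum_bij
    (fun q _ => ((Equiv.sumCongr q.2.1 q.2.2).trans (τ q.1)).trans e.symm) ?_ ?_ ?_ ?_
  · simp
  · rintro ⟨l, p⟩ _ ⟨l', p'⟩ _ h
    have h' : (Equiv.sumCongr p.1 p.2).trans (τ l) = (Equiv.sumCongr p'.1 p'.2).trans (τ l') := by
      ext r
      exact e.symm.injective (Equiv.congr_fun h r)
    obtain rfl : l = l' := (hτ ((Equiv.sumCongr p.1 p.2).trans (τ l))).unique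
      (hrange l p) (by rw [h']; exact hrange l' p')
    have h2 : Equiv.Perm.sumCongrHom ι κ p = Equiv.Perm.sumCongrHom ι κ p' := by
      ext1 r
      exact (τ l).injective (Equiv.congr_fun h' r)
    rw [Equiv.Perm.sumCongrHom_injective h2]
  · intro π _
    obtain ⟨l, hl, -⟩ := hτ (π.trans e)
    have hmem : π.trans (e.trans (τ l).symm) ∈ (Equiv.Perm.sumCongrHom ι κ).range := by
      refine Equiv.Perm.mem_sumCongrHom_range_of_perm_mapsTo_inl ?_
      rintro _ ⟨i, rfl⟩
      have : (π.trans e) (Sum.inl i) ∈ Set.range (τ l ∘ Sum.inl) := hl ▸ ⟨i, rfl⟩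
      obtain ⟨i', hi'⟩ := this
      exact ⟨i', by simpa [Equiv.eq_symm_apply] using hi'⟩
    obtain ⟨p, hp⟩ := hmem
    refine ⟨⟨l, p⟩, Finset.mem_univ _, ?_⟩
    ext1 r
    have := Equiv.congr_fun hp r
    simp only [Equiv.Perm.sumCongrHom_apply] at this
    simp [Equiv.trans_apply, this]
  · rintro ⟨l, p⟩ _
    simp

/-- The splitting of the columns into a subset of size `n` and its complement. -/
def splitEquiv {n m : ℕ} (S : {S : Finset (Fin (n + m)) // S.card = n}) :
    Fin n ⊕ Fin m ≃ Fin (n + m) :=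
  finSumEquivOfFinset S.2 (by rw [Finset.card_compl, S.2, Fintype.card_fin]; omega)

theorem range_splitEquiv_inl {n m : ℕ} (S : {S : Finset (Fin (n + m)) // S.card = n}) :
    Set.range (splitEquiv S ∘ Sum.inl) = (S : Set (Fin (n + m))) := by
  rw [← Finset.range_orderEmbOfFin S.1 S.2]
  rfl

theorem strictMono_splitEquiv_inl {n m : ℕ} (S : {S : Finset (Fin (n + m)) // S.card = n}) :
    StrictMono (fun a => splitEquiv S (Sum.inl a)) :=
  (S.1.orderEmbOfFin S.2).strictMono

theorem strictMono_splitEquiv_inr {n m : ℕ} (S : {S : Finset (Fin (n + m)) // S.card = n}) :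
    StrictMono (fun b => splitEquiv S (Sum.inr b)) :=
  (S.1ᶜ.orderEmbOfFin
    (by rw [Finset.card_compl, S.2, Fintype.card_fin]; omega)).strictMono

theorem existsUnique_splitEquiv {n m : ℕ} (σ : Fin n ⊕ Fin m ≃ Fin (n + m)) :
    ∃! S, Set.range (σ ∘ Sum.inl) = Set.range (splitEquiv S ∘ Sum.inl) := by
  simp only [range_splitEquiv_inl]
  refine ⟨⟨Finset.univ.image (σ ∘ Sum.inl), ?_⟩, by simp [Function.comp_def], fun T hT => ?_⟩
  · rw [Finset.card_image_of_injective _ (σ.injective.comp Sum.inl_injective)]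
    simp
  · ext1
    rw [← Finset.coe_inj, ← hT]
    simp [Function.comp_def]

/-- The number of columns outside `S` lying to the left of the `a`-th column of `S`; these are the
parts, in increasing order, of the partition attached to `S`. -/
def splitPart {n m : ℕ} (S : {S : Finset (Fin (n + m)) // S.card = n}) (a : Fin n) : ℕ :=
  (Finset.univ.filter fun b : Fin m => splitEquiv S (Sum.inr b) < splitEquiv S (Sum.inl a)).card

theorem card_filter_splitEquiv_lt {n m : ℕ} (S : {S : Finset (Fin (n + m)) // S.card = n})
    (c : Fin (n + m)) :
    (c : ℕ) = (Finset.univ.filter fun a => splitEquiv S (Sum.inl a) < c).card +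
      (Finset.univ.filter fun b => splitEquiv S (Sum.inr b) < c).card := by
  have h : (Finset.univ.filter fun z : Fin (n + m) => z < c).card = c := by
    rw [show (Finset.univ.filter fun z : Fin (n + m) => z < c) = Finset.Iio c by ext; simp]
    simp
  rw [← h, Finset.card_filter, Finset.card_filter, Finset.card_filter]
  rw [← Equiv.sum_comp (splitEquiv S), Fintype.sum_sum_type]

theorem splitEquiv_inl_eq {n m : ℕ} (S : {S : Finset (Fin (n + m)) // S.card = n}) (a : Fin n) :
    (splitEquiv S (Sum.inl a) : ℕ) = a + splitPart S a := by
  rw [card_filter_splitEquiv_lt S, splitPart]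
  simp only [(strictMono_splitEquiv_inl S).lt_iff_lt]
  rw [show (Finset.univ.filter fun z => z < a) = Finset.Iio a by ext; simp, Fin.card_Iio]

theorem lt_splitPart_iff {n m : ℕ} (S : {S : Finset (Fin (n + m)) // S.card = n}) (a : Fin n)
    (b : Fin m) :
    (b : ℕ) < splitPart S a ↔ splitEquiv S (Sum.inr b) < splitEquiv S (Sum.inl a) := by
  have hmono := strictMono_splitEquiv_inr S
  constructor
  · intro h
    by_contra hle
    refine h.not_ge ?_
    rw [← Fin.card_Iio]
    refine Finset.card_le_card fun b' hb' => ?_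
    simp only [Finset.mem_filter, Finset.mem_univ, true_and] at hb'
    exact Finset.mem_Iio.2 (hmono.lt_iff_lt.1 (hb'.trans_le (not_lt.1 hle)))
  · intro h
    refine Nat.lt_of_succ_le ?_
    rw [Nat.succ_eq_add_one, ← Fin.card_Iic]
    refine Finset.card_le_card fun b' hb' => ?_
    simp only [Finset.mem_filter, Finset.mem_univ, true_and]
    exact (hmono.monotone (Finset.mem_Iic.1 hb')).trans_lt h

theorem splitEquiv_inr_eq {n m : ℕ} (S : {S : Finset (Fin (n + m)) // S.card = n}) (b : Fin m) :
    (splitEquiv S (Sum.inr b) : ℕ) +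
      (Finset.univ.filter fun a : Fin n => (b : ℕ) < splitPart S a).card = n + b := by
  rw [card_filter_splitEquiv_lt S (splitEquiv S (Sum.inr b))]
  simp only [(strictMono_splitEquiv_inr S).lt_iff_lt, lt_splitPart_iff]
  rw [show (Finset.univ.filter fun z => z < b) = Finset.Iio b by ext; simp, Fin.card_Iio]
  have h := Finset.card_filter_add_card_filter_not (s := (Finset.univ : Finset (Fin n)))
    (fun a => splitEquiv S (Sum.inl a) < splitEquiv S (Sum.inr b))
  have h' : (Finset.univ.filter fun a => ¬ splitEquiv S (Sum.inl a) < splitEquiv S (Sum.inr b)) =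
      Finset.univ.filter fun a => splitEquiv S (Sum.inr b) < splitEquiv S (Sum.inl a) := by
    ext a
    have : splitEquiv S (Sum.inl a) ≠ splitEquiv S (Sum.inr b) := by simp
    simp [this.symm.le_iff_lt]
  rw [h', Finset.card_univ, Fintype.card_fin] at h
  omega

theorem monotone_splitPart {n m : ℕ} (S : {S : Finset (Fin (n + m)) // S.card = n}) :
    Monotone (splitPart S) := fun _ _ h =>
  Finset.card_le_card (Finset.monotone_filter_right _ fun _ _ hb =>
    lt_of_lt_of_le hb ((strictMono_splitEquiv_inl S).monotone h))

theorem splitPart_le {n m : ℕ} (S : {S : Finset (Fin (n + m)) // S.card = n}) (a : Fin n) :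
    splitPart S a ≤ m :=
  (Finset.card_filter_le _ _).trans (by simp)

theorem splitPart_injective {n m : ℕ} : Function.Injective (splitPart (n := n) (m := m)) := by
  intro S T h
  ext1
  rw [← Finset.coe_inj, ← range_splitEquiv_inl, ← range_splitEquiv_inl]
  congr 1
  ext a
  simp [splitEquiv_inl_eq, h]

theorem exists_splitPart_eq {n m : ℕ} {μ : Fin n → ℕ} (hμ : Monotone μ) (hm : ∀ a, μ a ≤ m) :
    ∃ S : {S : Finset (Fin (n + m)) // S.card = n}, splitPart S = μ := by
  let c : Fin n → Fin (n + m) := fun a => ⟨a + μ a, by have := hm a; omega⟩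
  have hc : StrictMono c := fun a a' h => by
    have := hμ h.le
    simp only [c, Fin.lt_def] at h ⊢
    omega
  have hS : (Finset.univ.image c).card = n := by
    rw [Finset.card_image_of_injective _ hc.injective]
    simp
  refine ⟨⟨_, hS⟩, funext fun a => ?_⟩
  have h := splitEquiv_inl_eq (m := m) ⟨_, hS⟩ a
  have h' : splitEquiv ⟨_, hS⟩ (Sum.inl a) = c a :=
    (congrFun (Finset.orderEmbOfFin_unique hS (fun x => by simp) hc) a).symm
  rw [h'] at h
  exact (Nat.add_left_cancel h).symm

theorem sign_splitEquiv {n m : ℕ} (S : {S : Finset (Fin (n + m)) // S.card = n}) :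
    Equiv.Perm.sign ((splitEquiv S).trans finSumFinEquiv.symm) =
      (-1) ^ ∑ a, splitPart S a := by
  have h : Equiv.Perm.sign ((splitEquiv S).trans finSumFinEquiv.symm) =
      Equiv.Perm.sign (finSumFinEquiv.symm.trans (splitEquiv S)) := by
    rw [← Equiv.Perm.sign_permCongr finSumFinEquiv]
    congr 1
    ext; simp
  rw [h, Equiv.Perm.sign_eq_prod_prod_Ioi, prod_Ioi_fin_add]
  simp only [Equiv.trans_apply, finSumFinEquiv_symm_apply_castAdd,
    finSumFinEquiv_symm_apply_natAdd]
  rw [Finset.prod_eq_one fun i _ => Finset.prod_eq_one fun j hj =>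
      if_pos (strictMono_splitEquiv_inl S (Finset.mem_Ioi.1 hj)), one_mul,
    Finset.prod_eq_one (f := fun k : Fin m => _) fun i _ => Finset.prod_eq_one fun j hj =>
      if_pos (strictMono_splitEquiv_inr S (Finset.mem_Ioi.1 hj)), mul_one,
    ← Finset.prod_pow_eq_pow_sum]
  refine Finset.prod_congr rfl fun a _ => ?_
  rw [splitPart, Finset.card_filter, ← Finset.prod_pow_eq_pow_sum]
  refine Finset.prod_congr rfl fun b _ => ?_
  have : splitEquiv S (Sum.inl a) ≠ splitEquiv S (Sum.inr b) := by simp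
  split_ifs <;> first | rfl | order

theorem schurFn_eq_det {R : Type*} [CommRing R] {N M : ℕ} (l : List ℕ) (hl : l.length ≤ M)
    (x : Fin N → R) :
    schurFn N l x =
      (Matrix.of fun i j : Fin M => hSymZ N x ((l.getD i 0 : ℤ) + (j : ℤ) - (i : ℤ))).det := by
  obtain ⟨k, rfl⟩ := Nat.exists_eq_add_of_le hl
  rw [← Matrix.det_submatrix_equiv_self finSumFinEquiv, ← Matrix.fromBlocks_toBlocks
    (Matrix.submatrix _ _ _)]
  have h21 : Matrix.toBlocks₂₁ ((Matrix.of fun i j : Fin (l.length + k) =>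
      hSymZ N x ((l.getD i 0 : ℤ) + (j : ℤ) - (i : ℤ))).submatrix finSumFinEquiv
        finSumFinEquiv) = 0 := by
    ext i j
    refine hSymZ_of_neg _ ?_
    simp
    omega
  have h22 : Matrix.toBlocks₂₂ ((Matrix.of fun i j : Fin (l.length + k) =>
      hSymZ N x ((l.getD i 0 : ℤ) + (j : ℤ) - (i : ℤ))).submatrix finSumFinEquiv
        finSumFinEquiv) = Matrix.of fun b c : Fin k => hSymZ N x ((c : ℤ) - b) := by
    ext i j
    simp [Matrix.toBlocks₂₂]
  rw [h21, h22, Matrix.det_fromBlocks_zero₂₁, det_hSymZ_sub_eq_one, mul_one, schurFn]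
  congr 1
  ext i j
  simp [Matrix.toBlocks₁₁]

theorem hSymZ_smul {R : Type*} [CommRing R] {N : ℕ} (t : R) (x : Fin N → R) (d : ℤ) :
    hSymZ N (fun i => t * x i) d = t ^ d.toNat * hSymZ N x d := by
  unfold hSymZ hSym
  split_ifs
  · rw [Finset.mul_sum]
    refine Finset.sum_congr rfl fun s _ => ?_
    rw [Multiset.prod_map_mul, Multiset.map_const', Multiset.prod_replicate]
    congr 2
    exact s.2
  · simp

theorem prod_hSymZ_smul {R ι : Type*} [CommRing R] [Fintype ι] {N : ℕ} (t : R) (x : Fin N → R)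
    (d : ι → ℤ) :
    ∏ i, hSymZ N (fun i => t * x i) (d i) = t ^ (∑ i, d i).toNat * ∏ i, hSymZ N x (d i) := by
  by_cases h : ∃ i, d i < 0
  · obtain ⟨i, hi⟩ := h
    rw [Finset.prod_eq_zero (Finset.mem_univ i) (hSymZ_of_neg _ hi),
      Finset.prod_eq_zero (Finset.mem_univ i) (hSymZ_of_neg _ hi), mul_zero]
  · push Not at h
    simp only [hSymZ_smul, Finset.prod_mul_distrib, Finset.prod_pow_eq_pow_sum]
    congr 2
    zify
    rw [Int.toNat_of_nonneg (Finset.sum_nonneg fun i _ => h i)]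
    exact Finset.sum_congr rfl fun i _ => Int.toNat_of_nonneg (h i)

theorem schurFn_smul {R : Type*} [CommRing R] {N : ℕ} (l : List ℕ) (t : R) (x : Fin N → R) :
    schurFn N l (fun i => t * x i) = t ^ l.sum * schurFn N l x := by
  rw [schurFn, schurFn, Matrix.det_apply', Matrix.det_apply', Finset.mul_sum]
  refine Finset.sum_congr rfl fun σ _ => ?_
  simp only [Matrix.of_apply]
  rw [prod_hSymZ_smul, mul_left_comm]
  congr 2
  rw [Finset.sum_sub_distrib, Finset.sum_add_distrib,
    Equiv.sum_comp σ (fun i : Fin l.length => (l.get i : ℤ)),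
    Equiv.sum_comp σ (fun i : Fin l.length => ((i : ℕ) : ℤ)), add_sub_cancel_right]
  have : l.sum = ∑ i : Fin l.length, l.get i := by
    conv_lhs => rw [← List.ofFn_get l, List.sum_ofFn]
  rw [this, ← Nat.cast_sum, Int.toNat_natCast]

theorem map_schurFn {R S : Type*} [CommRing R] [CommRing S] (f : R →+* S) {N : ℕ} (l : List ℕ)
    (x : Fin N → R) : f (schurFn N l x) = schurFn N l (f ∘ x) := by
  rw [schurFn, schurFn, RingHom.map_det]
  congr 1
  ext
  simp [map_hSymZ]

theorem getD_filter_ne_zero {l : List ℕ} (hl : l.Pairwise (· ≥ ·)) (i : ℕ) :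
    (l.filter (· ≠ 0)).getD i 0 = l.getD i 0 := by
  induction l generalizing i with
  | nil => rfl
  | cons a l ih =>
    rw [List.pairwise_cons] at hl
    rcases Nat.eq_zero_or_pos a with rfl | ha
    · have h0 : ∀ b ∈ l, b = 0 := fun b hb => Nat.le_zero.1 (hl.1 b hb)
      have : (0 :: l).filter (· ≠ 0) = [] := by simpa [List.filter_eq_nil_iff] using h0
      rw [this]
      cases i with
      | zero => rfl
      | succ i =>
        simp only [List.getD_nil, List.getD_cons_succ]
        rcases lt_or_ge i l.length with h | h
        · rw [List.getD_eq_getElem _ _ h, h0 _ (List.getElem_mem h)]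
        · rw [List.getD_eq_default _ _ h]
    · rw [List.filter_cons_of_pos (by simp; omega)]
      cases i with
      | zero => rfl
      | succ i => simpa using ih hl.2 i

theorem getD_conjList (l : List ℕ) (b : ℕ) :
    (conjList l).getD b 0 = Multiset.countP (b < ·) (l : Multiset ℕ) := by
  rw [Multiset.coe_countP, List.countP_eq_length_filter, conjList]
  have hmax : ∀ a ∈ l, a ≤ l.foldr max 0 := fun a ha => by
    induction l with
    | nil => simp at ha
    | cons c l ih =>
      rcases List.mem_cons.1 ha with rfl | ha
      · exact le_max_left _ _
      · exact (ih ha).trans (le_max_right _ _)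
  rcases lt_or_ge b (l.foldr max 0) with h | h
  · rw [List.getD_eq_getElem _ _ (by simpa using h)]
    simp
  · rw [List.getD_eq_default _ _ (by simpa using h), eq_comm, List.length_eq_zero_iff,
      List.filter_eq_nil_iff]
    intro a ha
    simpa using (hmax a ha).trans h

theorem length_conjList_le {l : List ℕ} {m : ℕ} (h : ∀ p ∈ l, p ≤ m) :
    (conjList l).length ≤ m := by
  rw [conjList, List.length_map, List.length_range]
  induction l with
  | nil => simp
  | cons a l ih =>
    exact max_le (h a (by simp)) (ih fun p hp => h p (by simp [hp]))

theorem coe_partsList {j : ℕ} (P : Nat.Partition j) : (partsList P : Multiset ℕ) = P.parts := by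
  rw [partsList, Multiset.coe_reverse, Multiset.sort_eq]

theorem length_partsList {j : ℕ} (P : Nat.Partition j) :
    (partsList P).length = P.parts.card := by
  rw [← coe_partsList, Multiset.coe_card]

theorem sum_partsList {j : ℕ} (P : Nat.Partition j) : (partsList P).sum = j := by
  rw [← Multiset.sum_coe, coe_partsList, P.parts_sum]

theorem pairwise_partsList {j : ℕ} (P : Nat.Partition j) :
    (partsList P).Pairwise (· ≥ ·) := by
  rw [partsList, List.pairwise_reverse]
  exact Multiset.pairwise_sort _ _

theorem getD_partsList_ofSums {n j : ℕ} {μ : Fin n → ℕ} (hμ : Monotone μ)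
    (h : (Finset.univ.val.map μ).sum = j) (a : Fin n) :
    (partsList (Nat.Partition.ofSums j _ h)).getD a 0 = μ a.rev := by
  have hw : (List.ofFn (μ ∘ Fin.rev)).Pairwise (· ≥ ·) := by
    rw [List.pairwise_ofFn]
    exact fun i i' hi => hμ (Fin.rev_le_rev.2 hi.le)
  have hperm : (List.ofFn (μ ∘ Fin.rev) : Multiset ℕ) = Finset.univ.val.map μ := by
    have h := Fin.univ_val_map (μ ∘ Fin.rev)
    rw [← h, ← Multiset.map_map]
    congr 1
    exact congrArg Finset.val (Finset.map_univ_equiv (Fin.revPerm (n := n)))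
  have : partsList (Nat.Partition.ofSums j _ h) =
      (List.ofFn (μ ∘ Fin.rev)).filter (· ≠ 0) := by
    refine List.Perm.eq_of_pairwise' (pairwise_partsList _) (hw.filter _) ?_
    rw [← Multiset.coe_eq_coe, coe_partsList, ← Multiset.filter_coe, hperm]
    rfl
  rw [this, getD_filter_ne_zero hw, List.getD_eq_getElem _ _ (by simp)]
  simp

theorem ofFn_getD {l : List ℕ} {n : ℕ} (h : l.length ≤ n) :
    List.ofFn (fun a : Fin n => l.getD a 0) = l ++ List.replicate (n - l.length) 0 := by
  refine List.ext_getElem (by simp [h]) fun i h1 h2 => ?_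
  rw [List.getElem_ofFn, List.getElem_append]
  split_ifs with hi
  · simp [hi]
  · rw [List.getD_eq_default _ _ (not_lt.1 hi)]
    simp

theorem antitone_getD {l : List ℕ} (hl : l.Pairwise (· ≥ ·)) : Antitone (l.getD · 0) := by
  intro i i' hi
  rcases lt_or_ge i' l.length with h | h
  · simp only [List.getD_eq_getElem _ _ h, List.getD_eq_getElem _ _ (hi.trans_lt h)]
    rcases hi.eq_or_lt with rfl | hlt
    · exact le_rfl
    · exact List.pairwise_iff_getElem.1 hl _ _ _ _ hlt
  · exact (List.getD_eq_default _ _ h).trans_le (Nat.zero_le _)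

theorem countP_parts_ofSums {n j : ℕ} (μ : Fin n → ℕ)
    (h : (Finset.univ.val.map μ).sum = j) (b : ℕ) :
    Multiset.countP (b < ·) (Nat.Partition.ofSums j _ h).parts =
      (Finset.univ.filter fun a => b < μ a).card := by
  rw [Nat.Partition.ofSums_parts, Multiset.countP_filter, Multiset.countP_map]
  change _ = ((Finset.univ.filter fun a => b < μ a).val).card
  rw [Finset.filter_val]
  congr 2
  ext a
  simp only [ne_eq, and_iff_left_iff_imp]
  omega

/-- The partition whose parts are the nonzero values of `splitPart S`. -/
def splitPartition {n m j : ℕ} (S : {S : Finset (Fin (n + m)) // S.card = n})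
    (h : ∑ a, splitPart S a = j) : Nat.Partition j :=
  Nat.Partition.ofSums j (Finset.univ.val.map (splitPart S))
    ((Finset.sum_eq_multiset_sum _ _).symm.trans h)

theorem card_parts_splitPartition_le {n m j : ℕ} (S : {S : Finset (Fin (n + m)) // S.card = n})
    (h : ∑ a, splitPart S a = j) : (splitPartition S h).parts.card ≤ n := by
  rw [splitPartition, Nat.Partition.ofSums_parts]
  exact (Multiset.card_le_card (Multiset.filter_le _ _)).trans (by simp)

theorem le_of_mem_parts_splitPartition {n m j p : ℕ}
    (S : {S : Finset (Fin (n + m)) // S.card = n}) (h : ∑ a, splitPart S a = j)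
    (hp : p ∈ (splitPartition S h).parts) : p ≤ m := by
  rw [splitPartition, Nat.Partition.ofSums_parts] at hp
  obtain ⟨a, -, rfl⟩ := Multiset.mem_map.1 (Multiset.mem_of_mem_filter hp)
  exact splitPart_le S a

theorem det_stackedMatrix_submatrix_inl {R : Type*} [CommRing R] {n m j : ℕ} (x : Fin n → R)
    (y : Fin m → R) (S : {S : Finset (Fin (n + m)) // S.card = n})
    (h : ∑ a, splitPart S a = j) :
    ((stackedMatrix x y).submatrix Sum.inl (splitEquiv S ∘ Sum.inl)).det =
      schurFn n (partsList (splitPartition S h)) x := by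
  have hle := card_parts_splitPartition_le S h
  rw [← length_partsList] at hle
  rw [schurFn_eq_det _ hle, ← Matrix.det_transpose,
    ← Matrix.det_submatrix_equiv_self Fin.revPerm]
  refine congrArg Matrix.det (Matrix.ext fun a b => ?_)
  have h1 := splitEquiv_inl_eq S a.rev
  have h2 : (partsList (splitPartition S h)).getD a 0 = splitPart S a.rev :=
    getD_partsList_ofSums (monotone_splitPart S) h a
  simp only [Matrix.submatrix_apply, Matrix.transpose_apply, Matrix.of_apply, stackedMatrix,
    Fin.revPerm_apply, Function.comp_apply, Sum.elim_inl, h1, h2]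
  congr 1
  have := Fin.val_rev a
  have := Fin.val_rev b
  omega

theorem det_stackedMatrix_submatrix_inr {R : Type*} [CommRing R] {n m j : ℕ} (x : Fin n → R)
    (y : Fin m → R) (S : {S : Finset (Fin (n + m)) // S.card = n})
    (h : ∑ a, splitPart S a = j) :
    ((stackedMatrix x y).submatrix Sum.inr (splitEquiv S ∘ Sum.inr)).det =
      schurFn m (conjList (partsList (splitPartition S h))) y := by
  have hle : ∀ p ∈ partsList (splitPartition S h), p ≤ m := fun p hp =>
    le_of_mem_parts_splitPartition S h (by rwa [← coe_partsList, Multiset.mem_coe])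
  rw [schurFn_eq_det _ (length_conjList_le hle), ← Matrix.det_transpose]
  refine congrArg Matrix.det (Matrix.ext fun a b => ?_)
  have h1 := splitEquiv_inr_eq S a
  have h2 : (conjList (partsList (splitPartition S h))).getD a 0 = _ :=
    (getD_conjList _ _).trans ((congrArg _ (coe_partsList _)).trans (countP_parts_ofSums _ h a))
  simp only [Matrix.submatrix_apply, Matrix.transpose_apply, Matrix.of_apply, stackedMatrix,
    Function.comp_apply, Sum.elim_inr, h2]
  congr 1
  omega

/-- Dual Cauchy identity, with the partitions in an `n × m` box encoded as `n`-subsets. -/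
theorem prod_one_sub_mul_eq_sum_schurFn {R : Type*} [CommRing R] {n m : ℕ} (t : R)
    (x : Fin n → R) (y : Fin m → R) :
    ∏ i, ∏ k, (1 - t * x i * y k) =
      ∑ S : {S : Finset (Fin (n + m)) // S.card = n}, (-1) ^ (∑ a, splitPart S a) *
        (t ^ (∑ a, splitPart S a) * (schurFn n (partsList (splitPartition S rfl)) x *
          schurFn m (conjList (partsList (splitPartition S rfl))) y)) := by
  rw [← det_stackedMatrix (fun i => t * x i) y,
    det_eq_sum_complementary_minors splitEquiv existsUnique_splitEquiv]
  refine Finset.sum_congr rfl fun S _ => ?_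
  rw [sign_splitEquiv, det_stackedMatrix_submatrix_inl _ _ S rfl,
    det_stackedMatrix_submatrix_inr _ _ S rfl, schurFn_smul, sum_partsList]
  push_cast
  ring

theorem parts_eq_map_getD {n j : ℕ} (P : Nat.Partition j) (hP : P.parts.card ≤ n) :
    P.parts = (Finset.univ.val.map fun a : Fin n => (partsList P).getD a 0).filter (· ≠ 0) := by
  rw [Fin.univ_val_map, ofFn_getD (by rwa [length_partsList]), ← Multiset.coe_add,
    Multiset.filter_add, coe_partsList, Multiset.filter_eq_self.2 fun p hp => (P.parts_pos hp).ne',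
    Multiset.filter_eq_nil.2, add_zero]
  simp

theorem exists_splitPartition_eq {n m j : ℕ} (P : Nat.Partition j) (hn : P.parts.card ≤ n)
    (hm : ∀ p ∈ P.parts, p ≤ m) :
    ∃ (S : {S : Finset (Fin (n + m)) // S.card = n}) (h : ∑ a, splitPart S a = j),
      splitPartition S h = P := by
  obtain ⟨S, hS⟩ := exists_splitPart_eq (n := n) (m := m)
    (μ := fun a => (partsList P).getD a.rev 0)
    (fun a b hab => antitone_getD (pairwise_partsList P) (Fin.rev_le_rev.2 hab)) fun a => by
      rcases lt_or_ge (a.rev : ℕ) (partsList P).length with h | h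
      · rw [List.getD_eq_getElem _ _ h]
        refine hm _ ?_
        rw [← coe_partsList]
        exact List.getElem_mem h
      · exact (List.getD_eq_default _ _ h).trans_le (Nat.zero_le _)
  have hmap : Finset.univ.val.map (splitPart S) =
      Finset.univ.val.map fun a : Fin n => (partsList P).getD a 0 := by
    rw [hS]
    conv_rhs => rw [← Finset.map_univ_equiv Fin.revPerm, Finset.map_val, Multiset.map_map]
    rfl
  have hfilter := (parts_eq_map_getD P hn).trans (congrArg _ hmap.symm)
  have hsum : ∑ a, splitPart S a = j := by
    rw [← P.parts_sum, hfilter, Finset.sum_eq_multiset_sum]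
    exact (Nat.Partition.ofSums _ _ rfl).parts_sum.symm
  exact ⟨S, hsum, Nat.Partition.ext hfilter.symm⟩

theorem splitPartition_injective {n m j : ℕ} {S T : {S : Finset (Fin (n + m)) // S.card = n}}
    (hS : ∑ a, splitPart S a = j) (hT : ∑ a, splitPart T a = j)
    (h : splitPartition S hS = splitPartition T hT) : S = T := by
  refine splitPart_injective (funext fun a => ?_)
  have h1 := getD_partsList_ofSums (monotone_splitPart S) hS a.rev
  have h2 := getD_partsList_ofSums (monotone_splitPart T) hT a.rev
  rw [Fin.rev_rev] at h1 h2
  exact h1.symm.trans ((congrArg (fun P => (partsList P).getD a.rev 0) h).trans h2)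

theorem coeff_prod_one_sub_mul {n m : ℕ} (j : ℕ) {R : Type*} [CommRing R] (x : Fin n → R)
    (y : Fin m → R) :
    (∏ i, ∏ k, (1 - C (x i * y k) * X) : R[X]).coeff j = (-1) ^ j *
      ∑ P ∈ Finset.univ.filter
          (fun P : Nat.Partition j => P.parts.card ≤ n ∧ ∀ p ∈ P.parts, p ≤ m),
        schurFn m (conjList (partsList P)) y * schurFn n (partsList P) x := by
  have hprod : (∏ i, ∏ k, (1 - C (x i * y k) * X) : R[X]) =
      ∏ i, ∏ k, (1 - X * (C ∘ x) i * (C ∘ y) k) := by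
    refine Finset.prod_congr rfl fun i _ => Finset.prod_congr rfl fun k _ => ?_
    simp only [Function.comp_apply, C_mul]
    ring
  have hcoeff (e : ℕ) (c : R) :
      ((-1) ^ e * (X ^ e * C c) : R[X]).coeff j = if e = j then (-1) ^ j * c else 0 := by
    have : ((-1) ^ e * (X ^ e * C c) : R[X]) = C ((-1) ^ e * c) * X ^ e := by
      simp only [C_mul, C_pow, C_neg, C_1]
      ring
    rw [this, coeff_C_mul_X_pow]
    aesop
  simp only [hprod, prod_one_sub_mul_eq_sum_schurFn, ← map_schurFn, ← C_mul, finsetSum_coeff,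
    hcoeff]
  rw [← Finset.sum_filter, Finset.mul_sum]
  refine Finset.sum_bij (fun S hS => splitPartition S (Finset.mem_filter.1 hS).2)
    (fun S hS => ?_) (fun S hS T hT h => splitPartition_injective _ _ h) (fun P hP => ?_)
    fun S hS => ?_
  · simpa using ⟨card_parts_splitPartition_le S _, fun p => le_of_mem_parts_splitPartition S _⟩
  · obtain ⟨hn, hm⟩ := (Finset.mem_filter.1 hP).2
    obtain ⟨S, h, hS⟩ := exists_splitPartition_eq P hn hm
    exact ⟨S, by simpa using h, hS⟩
  · obtain rfl := (Finset.mem_filter.1 hS).2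
    rw [mul_comm (schurFn m _ _)]

/-- Cauchy decomposition of exterior powers of a tensor product,
character form: for endomorphisms `f` of `V` (`dim V = n`, eigenvalues `ef`) and
`g` of `W` (`dim W = m`, eigenvalues `eg`), the trace of `Λ^j (f ⊗ g)` equals
`Σ_{|λ|=j} tr ρ_{λ'}(g) · tr ρ_λ(f)`, the sum being over partitions `λ` of `j`
with at most `n` rows and at most `m` columns, where `tr ρ_λ(f)` is the Schur
polynomial `s_λ` of the eigenvalues of `f`. -/
theorem traceExteriorPower_kronecker_eq_sum_schur
    (n m j : ℕ) (F : Matrix (Fin n) (Fin n) ℂ) (G : Matrix (Fin m) (Fin m) ℂ)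
    (ef : Fin n → ℂ) (eg : Fin m → ℂ)
    (hef : F.charpoly = ∏ i, (X - C (ef i)))
    (heg : G.charpoly = ∏ i, (X - C (eg i))) :
    traceExteriorPower j (Matrix.kroneckerMap (· * ·) F G)
      = ∑ P ∈ Finset.univ.filter
            (fun P : Nat.Partition j => P.parts.card ≤ n ∧ ∀ p ∈ P.parts, p ≤ m),
          schurFn m (conjList (partsList P)) eg * schurFn n (partsList P) ef := by
  rw [traceExteriorPower_eq_coeff, charpolyRev_kronecker F G ef eg hef heg,
    coeff_prod_one_sub_mul, ← mul_assoc, ← mul_pow, neg_one_mul, neg_neg, one_pow, one_mul]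

end
end

section
/- Let μ be a probability measure on GL_n(ℝ), invariant under left multiplication by O(n), satisfying the integrability condition that log⁺‖A‖ and log⁺‖A⁻¹‖ are μ-integrable, and let r₁ ≥ ... ≥ r_n be its random Lyapunov exponents. Then for each 1 ≤ k ≤ n, Σ_{i=1}^k r_i = ∫_{GL_n(ℝ)} ∫_{Gr(n,k)} log|det(A|_g)| dg dμ(A), where dg is the O(n)-invariant probability measure on the Grassmannian Gr(n,k) and A|_g : g → A g denotes the restriction of A, with |det(A|_g)| computed with respect to orthonormal bases of g and Ag. -/
open Matrix MeasureTheory Filter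

noncomputable section

/-- Frobenius norm of a matrix. -/
def frobNorm {ι κ : Type*} [Fintype ι] [Fintype κ] (M : Matrix ι κ ℝ) : ℝ :=
  Real.sqrt (∑ i, ∑ j, (M i j) ^ 2)

/-- `log⁺`. -/
def posLog (x : ℝ) : ℝ := max (Real.log x) 0

/-- The `k`-th compound (exterior power) matrix of `M`, indexed by the
`k`-element subsets of `Fin n` (with their increasing enumerations): the matrix
of `Λ^k M`. -/
def compound {n : ℕ} (k : ℕ) (M : Matrix (Fin n) (Fin n) ℝ) :
    Matrix {s : Finset (Fin n) // s.card = k} {s : Finset (Fin n) // s.card = k} ℝ :=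
  fun s t => (M.submatrix (fun i : Fin k => (s.1.orderIsoOfFin s.2 i : Fin n))
    (fun j : Fin k => (t.1.orderIsoOfFin t.2 j : Fin n))).det

/-- The first `k` standard basis vectors of `ℝⁿ`, as an `n × k` matrix; its
column space is the base point `g₀ = ℝᵏ × {0}` of the Grassmannian `Gr(n,k)`. -/
def stdIncl (n k : ℕ) : Matrix (Fin n) (Fin k) ℝ :=
  fun i j => if (i : ℕ) = (j : ℕ) then 1 else 0

/-- The Cauchy–Binet formula, summed over all maps rather than over subsets. -/
theorem factorial_mul_det_mul {ι : Type*} [Fintype ι] {k : ℕ}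
    (P : Matrix (Fin k) ι ℝ) (Q : Matrix ι (Fin k) ℝ) :
    (k.factorial : ℝ) * (P * Q).det =
      ∑ f : Fin k → ι, (P.submatrix id f).det * (Q.submatrix f id).det := by
  classical
  have expand : (P * Q).det = ∑ f : Fin k → ι, (∏ i, P i (f i)) * (Q.submatrix f id).det := by
    have hrow : P * Q = fun i => ∑ j, P i j • Q j := by
      ext i l
      simp [Matrix.mul_apply]
    rw [hrow]
    change detRowAlternating.toMultilinearMap (fun i => ∑ j, P i j • Q j) = _
    rw [MultilinearMap.map_sum]
    refine Finset.sum_congr rfl fun f _ => ?_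
    rw [MultilinearMap.map_smul_univ]
    rfl
  have reindex : ∀ σ : Equiv.Perm (Fin k), (P * Q).det =
      ∑ f : Fin k → ι, ((Equiv.Perm.sign σ : ℤ) : ℝ) * (∏ i, P i (f (σ i))) *
        (Q.submatrix f id).det := by
    intro σ
    rw [expand, ← (Equiv.arrowCongr σ.symm (Equiv.refl ι)).sum_comp]
    refine Finset.sum_congr rfl fun f _ => ?_
    have h1 : (Q.submatrix ((Equiv.arrowCongr σ.symm (Equiv.refl ι)) f) id).det =
        ((Equiv.Perm.sign σ : ℤ) : ℝ) * (Q.submatrix f id).det := by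
      rw [← Matrix.det_permute σ]
      rfl
    rw [h1]
    simp only [Equiv.arrowCongr_apply, Equiv.coe_refl, Equiv.symm_symm, Function.comp, id]
    ring
  have hsum : ∑ _σ : Equiv.Perm (Fin k), (P * Q).det = (k.factorial : ℝ) * (P * Q).det := by
    simp [Fintype.card_perm]
  rw [← hsum, Finset.sum_congr rfl fun σ _ => reindex σ, Finset.sum_comm]
  refine Finset.sum_congr rfl fun f _ => ?_
  rw [← Finset.sum_mul, ← Matrix.det_transpose (P.submatrix id f),
    Matrix.det_apply' (P.submatrix id f)ᵀ]
  rfl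

theorem factorial_mul_det_transpose_mul_self {ι : Type*} [Fintype ι] {k : ℕ}
    (X : Matrix ι (Fin k) ℝ) :
    (k.factorial : ℝ) * (Xᵀ * X).det = ∑ f : Fin k → ι, (X.submatrix f id).det ^ 2 := by
  rw [factorial_mul_det_mul]
  refine Finset.sum_congr rfl fun f _ => ?_
  rw [sq, ← Matrix.det_transpose (X.submatrix f id)]
  rfl

theorem det_transpose_mul_self_nonneg {ι : Type*} [Fintype ι] {k : ℕ}
    (X : Matrix ι (Fin k) ℝ) : 0 ≤ (Xᵀ * X).det := by
  have h := factorial_mul_det_transpose_mul_self X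
  have hk : (0 : ℝ) < k.factorial := by exact_mod_cast k.factorial_pos
  have h2 : 0 ≤ (k.factorial : ℝ) * (Xᵀ * X).det := by
    rw [h]; positivity
  exact nonneg_of_mul_nonneg_right h2 hk

theorem frobNorm_nonneg {ι κ : Type*} [Fintype ι] [Fintype κ] (M : Matrix ι κ ℝ) :
    0 ≤ frobNorm M := Real.sqrt_nonneg _

theorem frobNorm_sq {ι κ : Type*} [Fintype ι] [Fintype κ] (M : Matrix ι κ ℝ) :
    frobNorm M ^ 2 = ∑ i, ∑ j, (M i j) ^ 2 := Real.sq_sqrt (by positivity)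

theorem abs_apply_le_frobNorm {ι κ : Type*} [Fintype ι] [Fintype κ] (M : Matrix ι κ ℝ)
    (i : ι) (j : κ) : |M i j| ≤ frobNorm M := by
  apply Real.abs_le_sqrt
  calc M i j ^ 2 ≤ ∑ j, M i j ^ 2 :=
        Finset.single_le_sum (f := fun j => M i j ^ 2) (fun _ _ => sq_nonneg _) (Finset.mem_univ j)
    _ ≤ _ := Finset.single_le_sum (f := fun i => ∑ j, M i j ^ 2)
        (fun _ _ => Finset.sum_nonneg fun _ _ => sq_nonneg _) (Finset.mem_univ i)

theorem frobNorm_mul_le {ι : Type*} [Fintype ι] (M N : Matrix ι ι ℝ) :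
    frobNorm (M * N) ≤ frobNorm M * frobNorm N := by
  apply Real.sqrt_le_iff.2 ⟨mul_nonneg (frobNorm_nonneg _) (frobNorm_nonneg _), ?_⟩
  rw [mul_pow, frobNorm_sq, frobNorm_sq, Finset.sum_mul]
  refine Finset.sum_le_sum fun i _ => ?_
  rw [Finset.sum_comm (f := fun i j => N i j ^ 2), Finset.mul_sum]
  refine Finset.sum_le_sum fun j _ => ?_
  rw [Matrix.mul_apply]
  exact Finset.sum_mul_sq_le_sq_mul_sq _ _ _

theorem frobNorm_sq_eq_trace {ι κ : Type*} [Fintype ι] [Fintype κ] (M : Matrix ι κ ℝ) :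
    frobNorm M ^ 2 = (Mᵀ * M).trace := by
  rw [frobNorm_sq, Finset.sum_comm]
  simp [Matrix.trace, Matrix.mul_apply, sq]

theorem frobNorm_orthogonal_mul {n : ℕ} (U : Matrix.orthogonalGroup (Fin n) ℝ)
    (M : Matrix (Fin n) (Fin n) ℝ) :
    frobNorm ((U : Matrix (Fin n) (Fin n) ℝ) * M) = frobNorm M := by
  have hU : (U : Matrix (Fin n) (Fin n) ℝ)ᵀ * U = 1 := (Matrix.mem_orthogonalGroup_iff' _ _).1 U.2
  have h : frobNorm ((U : Matrix (Fin n) (Fin n) ℝ) * M) ^ 2 = frobNorm M ^ 2 := by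
    rw [frobNorm_sq_eq_trace, frobNorm_sq_eq_trace, Matrix.transpose_mul, Matrix.mul_assoc,
      ← Matrix.mul_assoc _ _ M, hU, Matrix.one_mul]
  exact (sq_eq_sq₀ (frobNorm_nonneg _) (frobNorm_nonneg _)).1 h

theorem frobNorm_transpose {ι κ : Type*} [Fintype ι] [Fintype κ] (M : Matrix ι κ ℝ) :
    frobNorm Mᵀ = frobNorm M := by
  simp only [frobNorm, Matrix.transpose_apply]
  rw [Finset.sum_comm]

theorem frobNorm_mul_orthogonal {n : ℕ} (U : Matrix.orthogonalGroup (Fin n) ℝ)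
    (M : Matrix (Fin n) (Fin n) ℝ) :
    frobNorm (M * (U : Matrix (Fin n) (Fin n) ℝ)) = frobNorm M := by
  rw [← frobNorm_transpose, Matrix.transpose_mul, ← frobNorm_transpose M]
  exact frobNorm_orthogonal_mul U⁻¹ Mᵀ

/-- Every minor of order `k` is bounded by the Frobenius norm of the compound matrix. -/
theorem abs_det_submatrix_le_frobNorm_compound {n k : ℕ} (M : Matrix (Fin n) (Fin n) ℝ)
    (f g : Fin k → Fin n) : |(M.submatrix f g).det| ≤ frobNorm (compound k M) := by
  classical
  by_cases hf : Function.Injective f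
  swap
  · obtain ⟨a, b, hab, hne⟩ := Function.not_injective_iff.1 hf
    rw [Matrix.det_zero_of_row_eq hne (by ext j; simp [hab]), abs_zero]
    exact frobNorm_nonneg _
  by_cases hg : Function.Injective g
  swap
  · obtain ⟨a, b, hab, hne⟩ := Function.not_injective_iff.1 hg
    rw [Matrix.det_zero_of_column_eq hne (by intro j; simp [hab]), abs_zero]
    exact frobNorm_nonneg _
  have key : ∀ f : Fin k → Fin n, Function.Injective f →
      ∃ (S : {s : Finset (Fin n) // s.card = k}) (e : Fin k ≃ Fin k),
        f = fun i => ((S.1.orderIsoOfFin S.2 (e i) : S.1) : Fin n) := by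
    intro f hf
    have hS : (Finset.univ.image f).card = k := by
      rw [Finset.card_image_of_injective _ hf]; simp
    let e₁ : Fin k → (Finset.univ.image f : Finset (Fin n)) := fun i => ⟨f i, by simp⟩
    have he₁ : Function.Bijective e₁ := by
      rw [Fintype.bijective_iff_injective_and_card]
      refine ⟨fun a b hab => hf (congrArg Subtype.val hab), ?_⟩
      rw [Fintype.card_coe, hS, Fintype.card_fin]
    refine ⟨⟨_, hS⟩, (Equiv.ofBijective e₁ he₁).trans
      (Finset.orderIsoOfFin _ hS).symm.toEquiv, ?_⟩
    ext i
    simp [e₁]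
  obtain ⟨S, e, he⟩ := key f hf
  obtain ⟨T, e', he'⟩ := key g hg
  have h : M.submatrix f g = ((M.submatrix
      (fun i : Fin k => (S.1.orderIsoOfFin S.2 i : Fin n))
      (fun j : Fin k => (T.1.orderIsoOfFin T.2 j : Fin n))).submatrix e e') := by
    rw [he, he']; rfl
  rw [h, Matrix.abs_det_submatrix_equiv_equiv]
  exact abs_apply_le_frobNorm (compound k M) S T

theorem det_submatrix_sq_le {ι : Type*} [Fintype ι] {k : ℕ} (X : Matrix ι (Fin k) ℝ)
    (f : Fin k → ι) : (X.submatrix f id).det ^ 2 ≤ k.factorial * (Xᵀ * X).det := by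
  rw [factorial_mul_det_transpose_mul_self]
  exact Finset.single_le_sum (f := fun f : Fin k → ι => (X.submatrix f id).det ^ 2)
    (fun _ _ => sq_nonneg _) (Finset.mem_univ f)

theorem one_le_factorial_cast (k : ℕ) : (1 : ℝ) ≤ k.factorial := by
  exact_mod_cast k.factorial_pos

/-- The operator inequality `‖Λᵏ M ω‖ ≤ C ‖Λᵏ M‖ ‖ω‖` on decomposable vectors. -/
theorem det_gram_mul_le {n k : ℕ} (M : Matrix (Fin n) (Fin n) ℝ) (X : Matrix (Fin n) (Fin k) ℝ) :
    ((M * X)ᵀ * (M * X)).det ≤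
      ((n : ℝ) ^ k) ^ 2 * frobNorm (compound k M) ^ 2 * (Xᵀ * X).det := by
  have hk := one_le_factorial_cast k
  have hG := det_transpose_mul_self_nonneg X
  have hminor : ∀ f : Fin k → Fin n, ((M * X).submatrix f id).det ^ 2 ≤
      (n : ℝ) ^ k * frobNorm (compound k M) ^ 2 * (k.factorial * (Xᵀ * X).det) := by
    intro f
    have h1 : (k.factorial : ℝ) * ((M * X).submatrix f id).det =
        ∑ g : Fin k → Fin n, (M.submatrix f g).det * (X.submatrix g id).det :=
      factorial_mul_det_mul (M.submatrix f id) X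
    have h2 := Finset.sum_mul_sq_le_sq_mul_sq Finset.univ
      (fun g : Fin k → Fin n => (M.submatrix f g).det) (fun g => (X.submatrix g id).det)
    rw [← h1, ← factorial_mul_det_transpose_mul_self] at h2
    have h3 : ∑ g : Fin k → Fin n, (M.submatrix f g).det ^ 2 ≤
        (n : ℝ) ^ k * frobNorm (compound k M) ^ 2 := by
      calc ∑ g : Fin k → Fin n, (M.submatrix f g).det ^ 2
          ≤ ∑ _g : Fin k → Fin n, frobNorm (compound k M) ^ 2 :=
            Finset.sum_le_sum fun g _ => sq_le_sq.2 (by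
              rw [abs_of_nonneg (frobNorm_nonneg _)]
              exact abs_det_submatrix_le_frobNorm_compound M f g)
        _ = _ := by simp
    calc ((M * X).submatrix f id).det ^ 2
        ≤ ((k.factorial : ℝ) * ((M * X).submatrix f id).det) ^ 2 := by
          rw [mul_pow]
          exact le_mul_of_one_le_left (sq_nonneg _) (one_le_pow₀ hk)
      _ ≤ _ := h2
      _ ≤ _ := mul_le_mul_of_nonneg_right h3 (by positivity)
  have hsum : (k.factorial : ℝ) * ((M * X)ᵀ * (M * X)).det ≤
      k.factorial * (((n : ℝ) ^ k) ^ 2 * frobNorm (compound k M) ^ 2 * (Xᵀ * X).det) := by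
    rw [factorial_mul_det_transpose_mul_self]
    refine (Finset.sum_le_sum fun f _ => hminor f).trans_eq ?_
    simp
    ring
  exact le_of_mul_le_mul_left hsum (by positivity)

theorem frobNorm_compound_le {n : ℕ} (k : ℕ) (M : Matrix (Fin n) (Fin n) ℝ) :
    frobNorm (compound k M) ≤
      Fintype.card {s : Finset (Fin n) // s.card = k} * (k.factorial * frobNorm M ^ k) := by
  have hM := frobNorm_nonneg M
  apply Real.sqrt_le_iff.2 ⟨by positivity, ?_⟩
  have hentry : ∀ S T, compound k M S T ^ 2 ≤ (k.factorial * frobNorm M ^ k) ^ 2 := by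
    intro S T
    rw [sq_le_sq, abs_of_nonneg (by positivity : 0 ≤ k.factorial * frobNorm M ^ k)]
    have h := Matrix.det_le (A := M.submatrix (fun i : Fin k => (S.1.orderIsoOfFin S.2 i : Fin n))
      (fun j : Fin k => (T.1.orderIsoOfFin T.2 j : Fin n))) (abv := AbsoluteValue.abs)
      (x := frobNorm M) (fun i j => abs_apply_le_frobNorm M _ _)
    rw [nsmul_eq_mul, Fintype.card_fin] at h
    exact h
  calc ∑ S, ∑ T, compound k M S T ^ 2
      ≤ ∑ _S : {s : Finset (Fin n) // s.card = k}, ∑ _T : {s : Finset (Fin n) // s.card = k},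
          (k.factorial * frobNorm M ^ k) ^ 2 :=
        Finset.sum_le_sum fun S _ => Finset.sum_le_sum fun T _ => hentry S T
    _ = _ := by
        simp only [Finset.sum_const, Finset.card_univ, nsmul_eq_mul]
        ring

theorem orthogonal_transpose_mul_self {n : ℕ} (U : Matrix.orthogonalGroup (Fin n) ℝ) :
    (U : Matrix (Fin n) (Fin n) ℝ)ᵀ * U = 1 := (Matrix.mem_orthogonalGroup_iff' _ _).1 U.2

theorem gram_orthogonal_mul {n k : ℕ} (U : Matrix.orthogonalGroup (Fin n) ℝ)
    (X : Matrix (Fin n) (Fin k) ℝ) :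
    ((U : Matrix (Fin n) (Fin n) ℝ) * X)ᵀ * ((U : Matrix (Fin n) (Fin n) ℝ) * X) = Xᵀ * X := by
  rw [Matrix.transpose_mul, Matrix.mul_assoc, ← Matrix.mul_assoc _ _ X,
    orthogonal_transpose_mul_self, Matrix.one_mul]

/-- Diagonalizing `Mᵀ M` expresses Gram determinants of `M X` through minors of `K X`. -/
theorem exists_orthogonal_det_gram_mul {n : ℕ} (k : ℕ) (M : Matrix (Fin n) (Fin n) ℝ) :
    ∃ (K : Matrix.orthogonalGroup (Fin n) ℝ) (w : (Fin k → Fin n) → ℝ), (∀ f, 0 ≤ w f) ∧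
      ∀ X : Matrix (Fin n) (Fin k) ℝ, (k.factorial : ℝ) * ((M * X)ᵀ * (M * X)).det =
        ∑ f, w f * (((K : Matrix (Fin n) (Fin n) ℝ) * X).submatrix f id).det ^ 2 := by
  have hpos : (Mᵀ * M).PosSemidef := by
    simpa using Matrix.posSemidef_conjTranspose_mul_self M
  have hH := hpos.isHermitian
  set V : Matrix.orthogonalGroup (Fin n) ℝ := hH.eigenvectorUnitary
  have hspec : Mᵀ * M = (V : Matrix (Fin n) (Fin n) ℝ) * diagonal hH.eigenvalues *
      (V : Matrix (Fin n) (Fin n) ℝ)ᵀ := by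
    have h := hH.spectral_theorem
    rw [Unitary.conjStarAlgAut_apply] at h
    exact h
  have hd : ∀ i, 0 ≤ hH.eigenvalues i := hpos.eigenvalues_nonneg
  generalize hH.eigenvalues = d at hspec hd
  refine ⟨V⁻¹, fun f => ∏ i, d (f i), fun f => Finset.prod_nonneg fun i _ => hd _, fun X => ?_⟩
  have hVinv : ((V⁻¹ : Matrix.orthogonalGroup (Fin n) ℝ) : Matrix (Fin n) (Fin n) ℝ) =
      (V : Matrix (Fin n) (Fin n) ℝ)ᵀ := rfl
  rw [hVinv]
  set Y := (V : Matrix (Fin n) (Fin n) ℝ)ᵀ * X with hY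
  have hfact : (M * X)ᵀ * (M * X) = Yᵀ * (diagonal d * Y) := by
    calc (M * X)ᵀ * (M * X) = Xᵀ * (Mᵀ * M) * X := by
          rw [Matrix.transpose_mul]; simp only [Matrix.mul_assoc]
      _ = _ := by
          rw [hspec, hY, Matrix.transpose_mul, Matrix.transpose_transpose]
          simp only [Matrix.mul_assoc]
  rw [hfact, factorial_mul_det_mul]
  refine Finset.sum_congr rfl fun f _ => ?_
  have h1 : (diagonal d * Y).submatrix f id =
      diagonal (fun i => d (f i)) * Y.submatrix f id := by
    ext i j
    simp [Matrix.diagonal_mul]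
  have h2 : (Yᵀ.submatrix id f).det = (Y.submatrix f id).det := by
    rw [← Matrix.det_transpose (Y.submatrix f id)]; rfl
  rw [h1, Matrix.det_mul, Matrix.det_diagonal, h2]
  ring

/-- Lower bound for Gram determinants of `M X` by a single minor of a rotated frame, up to the
norm of the compound matrix. -/
theorem exists_orthogonal_frobNorm_compound_mul_le {n k : ℕ} (hkn : k ≤ n)
    (M : Matrix (Fin n) (Fin n) ℝ) :
    ∃ (K : Matrix.orthogonalGroup (Fin n) ℝ) (f : Fin k → Fin n), Function.Injective f ∧
      ∀ X : Matrix (Fin n) (Fin k) ℝ, frobNorm (compound k M) ^ 2 *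
        (((K : Matrix (Fin n) (Fin n) ℝ) * X).submatrix f id).det ^ 2 ≤
        ((Fintype.card {s : Finset (Fin n) // s.card = k} : ℝ) * k.factorial) ^ 2 * k.factorial *
          ((M * X)ᵀ * (M * X)).det := by
  classical
  obtain ⟨K, w, hw, hK⟩ := exists_orthogonal_det_gram_mul k M
  have hne : (Finset.univ.filter fun f : Fin k → Fin n => Function.Injective f).Nonempty :=
    ⟨Fin.castLE hkn, by simpa using Fin.castLE_injective hkn⟩
  obtain ⟨f, hf, hmax⟩ := Finset.exists_max_image _ w hne
  have hfinj : Function.Injective f := by simpa using hf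
  refine ⟨K, f, hfinj, fun X => ?_⟩
  have hk := one_le_factorial_cast k
  have hterm : ∀ (Y : Matrix (Fin n) (Fin k) ℝ) (g : Fin k → Fin n),
      w g * (Y.submatrix g id).det ^ 2 ≤ w f * (Y.submatrix g id).det ^ 2 := by
    intro Y g
    by_cases hg : Function.Injective g
    · exact mul_le_mul_of_nonneg_right (hmax g (by simpa using hg)) (sq_nonneg _)
    · obtain ⟨a, b, hab, hne⟩ := Function.not_injective_iff.1 hg
      rw [Matrix.det_zero_of_row_eq hne (by ext j; simp [hab])]
      simp
  have hX : ∀ g, w g * (((K : Matrix (Fin n) (Fin n) ℝ) * X).submatrix g id).det ^ 2 ≤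
      k.factorial * ((M * X)ᵀ * (M * X)).det := by
    intro g
    rw [hK]
    exact Finset.single_le_sum (f := fun g => w g *
      (((K : Matrix (Fin n) (Fin n) ℝ) * X).submatrix g id).det ^ 2)
      (fun g _ => mul_nonneg (hw g) (sq_nonneg _)) (Finset.mem_univ g)
  have hentry : ∀ S T, compound k M S T ^ 2 ≤ k.factorial ^ 2 * w f := by
    intro S T
    set E : Matrix (Fin n) (Fin k) ℝ := (1 : Matrix (Fin n) (Fin n) ℝ).submatrix id
      (fun j : Fin k => (T.1.orderIsoOfFin T.2 j : Fin n)) with hE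
    have hME : M * E = M.submatrix id (fun j : Fin k => (T.1.orderIsoOfFin T.2 j : Fin n)) := by
      rw [hE]
      ext i j
      simp [Matrix.mul_apply, Matrix.one_apply]
    have hEE : Eᵀ * E = 1 := by
      ext i j
      simp [hE, Matrix.mul_apply, Matrix.one_apply]
    have h1 : compound k M S T ^ 2 ≤ k.factorial * ((M * E)ᵀ * (M * E)).det := by
      have := det_submatrix_sq_le (M * E) (fun i : Fin k => (S.1.orderIsoOfFin S.2 i : Fin n))
      rw [hME] at this ⊢
      exact this
    have h2 : (k.factorial : ℝ) * ((M * E)ᵀ * (M * E)).det ≤ w f * k.factorial := by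
      rw [hK]
      calc _ ≤ ∑ g, w f * (((K : Matrix (Fin n) (Fin n) ℝ) * E).submatrix g id).det ^ 2 :=
            Finset.sum_le_sum fun g _ => hterm _ g
        _ = _ := by
            rw [← Finset.mul_sum, ← factorial_mul_det_transpose_mul_self, gram_orthogonal_mul, hEE]
            simp
    have h3 : w f * k.factorial ≤ k.factorial ^ 2 * w f := by
      nlinarith [mul_nonneg (hw f) (by positivity : (0 : ℝ) ≤ k.factorial)]
    exact (h1.trans h2).trans h3
  have hc : frobNorm (compound k M) ^ 2 ≤
      ((Fintype.card {s : Finset (Fin n) // s.card = k} : ℝ) * k.factorial) ^ 2 * w f := by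
    rw [frobNorm_sq]
    refine (Finset.sum_le_sum fun S _ => Finset.sum_le_sum fun T _ => hentry S T).trans_eq ?_
    simp only [Finset.sum_const, Finset.card_univ, nsmul_eq_mul]
    ring
  calc _ ≤ ((Fintype.card {s : Finset (Fin n) // s.card = k} : ℝ) * k.factorial) ^ 2 * w f *
        (((K : Matrix (Fin n) (Fin n) ℝ) * X).submatrix f id).det ^ 2 :=
        mul_le_mul_of_nonneg_right hc (sq_nonneg _)
    _ ≤ _ := by
      rw [mul_assoc, mul_assoc _ (k.factorial : ℝ)]
      exact mul_le_mul_of_nonneg_left (hX f) (by positivity)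

/-- The logarithm of the `k`-dimensional volume spanned by the columns of `X`. -/
def gramLog {n k : ℕ} (X : Matrix (Fin n) (Fin k) ℝ) : ℝ :=
  Real.log (Real.sqrt (Xᵀ * X).det)

/-- The logarithmic size of a matrix and its inverse. -/
def logSize {n : ℕ} (M : Matrix (Fin n) (Fin n) ℝ) : ℝ :=
  posLog (frobNorm M) + posLog (frobNorm M⁻¹)

theorem posLog_nonneg (x : ℝ) : 0 ≤ posLog x := le_max_right _ _

theorem log_le_posLog (x : ℝ) : Real.log x ≤ posLog x := le_max_left _ _

theorem posLog_eq (x : ℝ) : posLog x = Real.posLog x := by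
  rw [Real.posLog_apply]
  exact max_comm _ _

theorem posLog_frobNorm_mul_le {ι : Type*} [Fintype ι] (M N : Matrix ι ι ℝ) :
    posLog (frobNorm (M * N)) ≤ posLog (frobNorm M) + posLog (frobNorm N) := by
  simp only [posLog_eq]
  exact (Real.posLog_le_posLog (frobNorm_nonneg _) (frobNorm_mul_le M N)).trans Real.posLog_mul

theorem logSize_nonneg {n : ℕ} (M : Matrix (Fin n) (Fin n) ℝ) : 0 ≤ logSize M :=
  add_nonneg (posLog_nonneg _) (posLog_nonneg _)

theorem logSize_mul_le {n : ℕ} (M N : Matrix (Fin n) (Fin n) ℝ) :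
    logSize (M * N) ≤ logSize M + logSize N := by
  have h1 := posLog_frobNorm_mul_le M N
  have h2 := posLog_frobNorm_mul_le N⁻¹ M⁻¹
  rw [← Matrix.mul_inv_rev] at h2
  unfold logSize
  linarith

theorem isUnit_det_orthogonal {n : ℕ} (U : Matrix.orthogonalGroup (Fin n) ℝ) :
    IsUnit (U : Matrix (Fin n) (Fin n) ℝ).det :=
  Matrix.isUnit_det_of_left_inverse (orthogonal_transpose_mul_self U)

theorem logSize_orthogonal_mul {n : ℕ} (U : Matrix.orthogonalGroup (Fin n) ℝ)
    (M : Matrix (Fin n) (Fin n) ℝ) :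
    logSize ((U : Matrix (Fin n) (Fin n) ℝ) * M) = logSize M := by
  have h : (U : Matrix (Fin n) (Fin n) ℝ)⁻¹ =
      ((U⁻¹ : Matrix.orthogonalGroup (Fin n) ℝ) : Matrix (Fin n) (Fin n) ℝ) :=
    Matrix.inv_eq_left_inv (orthogonal_transpose_mul_self U)
  rw [logSize, Matrix.mul_inv_rev, frobNorm_orthogonal_mul, h, frobNorm_mul_orthogonal, logSize]

theorem det_gram_mul_pos {n k : ℕ} {M : Matrix (Fin n) (Fin n) ℝ} (hM : IsUnit M.det)
    {X : Matrix (Fin n) (Fin k) ℝ} (hX : 0 < (Xᵀ * X).det) :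
    0 < ((M * X)ᵀ * (M * X)).det := by
  have h := det_gram_mul_le M⁻¹ (M * X)
  rw [← Matrix.mul_assoc M⁻¹, Matrix.nonsing_inv_mul _ hM, Matrix.one_mul] at h
  refine lt_of_le_of_ne (det_transpose_mul_self_nonneg _) fun h0 => ?_
  rw [← h0, mul_zero] at h
  linarith

theorem frobNorm_compound_pos {n k : ℕ} {M : Matrix (Fin n) (Fin n) ℝ} (hM : IsUnit M.det)
    {X : Matrix (Fin n) (Fin k) ℝ} (hX : 0 < (Xᵀ * X).det) : 0 < frobNorm (compound k M) := by
  have h := (det_gram_mul_pos hM hX).trans_le (det_gram_mul_le M X)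
  refine lt_of_le_of_ne (frobNorm_nonneg _) fun h0 => ?_
  rw [← h0] at h
  simp at h

theorem gramLog_mul_le {n k : ℕ} {M : Matrix (Fin n) (Fin n) ℝ} (hM : IsUnit M.det)
    {X : Matrix (Fin n) (Fin k) ℝ} (hX : 0 < (Xᵀ * X).det) :
    gramLog (M * X) ≤
      Real.log ((n : ℝ) ^ k) + Real.log (frobNorm (compound k M)) + gramLog X := by
  have h1 := det_gram_mul_pos hM hX
  have h2 := det_gram_mul_le M X
  have hc := frobNorm_compound_pos hM hX
  have hn : (n : ℝ) ^ k ≠ 0 := fun h0 => by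
    rw [h0] at h2
    simp only [ne_eq, OfNat.ofNat_ne_zero, not_false_eq_true, zero_pow, zero_mul] at h2
    linarith
  unfold gramLog
  rw [← Real.log_mul hn hc.ne', ← Real.log_mul (mul_ne_zero hn hc.ne') (Real.sqrt_pos.2 hX).ne']
  apply Real.log_le_log (Real.sqrt_pos.2 h1)
  apply Real.sqrt_le_iff.2 ⟨by positivity, ?_⟩
  rw [mul_pow, mul_pow, Real.sq_sqrt hX.le]
  exact h2

theorem log_frobNorm_compound_le {n k : ℕ} {M : Matrix (Fin n) (Fin n) ℝ} (hM : IsUnit M.det)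
    {X : Matrix (Fin n) (Fin k) ℝ} (hX : 0 < (Xᵀ * X).det) :
    Real.log (frobNorm (compound k M)) ≤
      Real.log (Fintype.card {s : Finset (Fin n) // s.card = k} * k.factorial) +
        k * posLog (frobNorm M) := by
  have hc := frobNorm_compound_pos hM hX
  have hle := frobNorm_compound_le k M
  rw [← mul_assoc] at hle
  have hprod := hc.trans_le hle
  have hle' := Real.log_le_log hc hle
  rw [Real.log_mul (left_ne_zero_of_mul hprod.ne') (right_ne_zero_of_mul hprod.ne'),
    Real.log_pow] at hle'
  have := mul_le_mul_of_nonneg_left (log_le_posLog (frobNorm M)) (Nat.cast_nonneg (α := ℝ) k)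
  linarith

theorem exists_orthogonal_log_le {n k : ℕ} (hkn : k ≤ n) {M : Matrix (Fin n) (Fin n) ℝ}
    (hM : IsUnit M.det) :
    ∃ (K : Matrix.orthogonalGroup (Fin n) ℝ) (f : Fin k → Fin n), Function.Injective f ∧
      ∀ X : Matrix (Fin n) (Fin k) ℝ, 0 < (Xᵀ * X).det →
        (((K : Matrix (Fin n) (Fin n) ℝ) * X).submatrix f id).det ≠ 0 →
        Real.log (frobNorm (compound k M)) +
          Real.log |(((K : Matrix (Fin n) (Fin n) ℝ) * X).submatrix f id).det| ≤
        Real.log (Real.sqrt (((Fintype.card {s : Finset (Fin n) // s.card = k} : ℝ) *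
          k.factorial) ^ 2 * k.factorial)) + gramLog (M * X) := by
  obtain ⟨K, f, hf, h⟩ := exists_orthogonal_frobNorm_compound_mul_le hkn M
  refine ⟨K, f, hf, fun X hX hdet => ?_⟩
  have hc := frobNorm_compound_pos hM hX
  have h1 := det_gram_mul_pos hM hX
  have h2 := h X
  have h3 : 0 < frobNorm (compound k M) ^ 2 *
      (((K : Matrix (Fin n) (Fin n) ℝ) * X).submatrix f id).det ^ 2 := by positivity
  have h4 := left_ne_zero_of_mul (h3.trans_le h2).ne'
  have h5 : 0 < ((Fintype.card {s : Finset (Fin n) // s.card = k} : ℝ) *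
      k.factorial) ^ 2 * k.factorial := lt_of_le_of_ne (by positivity) h4.symm
  unfold gramLog
  rw [← Real.log_mul hc.ne' (abs_pos.2 hdet).ne', ← Real.log_mul (Real.sqrt_pos.2 h5).ne'
    (Real.sqrt_pos.2 h1).ne', ← Real.sqrt_mul h5.le]
  apply Real.log_le_log (by positivity)
  apply Real.le_sqrt_of_sq_le
  rw [mul_pow, sq_abs]
  exact h2

theorem abs_gramLog_mul_le {n k : ℕ} {M : Matrix (Fin n) (Fin n) ℝ} (hM : IsUnit M.det)
    {X : Matrix (Fin n) (Fin k) ℝ} (hX : Xᵀ * X = 1) :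
    |gramLog (M * X)| ≤ |Real.log ((n : ℝ) ^ k)| +
      |Real.log (Fintype.card {s : Finset (Fin n) // s.card = k} * k.factorial)| +
        k * logSize M := by
  have hX' : 0 < (Xᵀ * X).det := by rw [hX]; simp
  have hMi : IsUnit M⁻¹.det := by
    rw [Matrix.det_nonsing_inv]; exact hM.ringInverse
  have hgX : gramLog X = 0 := by simp [gramLog, hX]
  have h1 := gramLog_mul_le hM hX'
  have h2 := log_frobNorm_compound_le hM hX'
  have h3 := gramLog_mul_le hMi (det_gram_mul_pos hM hX')
  have h4 := log_frobNorm_compound_le hMi hX'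
  rw [← Matrix.mul_assoc, Matrix.nonsing_inv_mul _ hM, Matrix.one_mul] at h3
  rw [hgX] at h1 h3
  have hk := Nat.cast_nonneg (α := ℝ) k
  have e1 := mul_nonneg hk (posLog_nonneg (frobNorm M))
  have e2 := mul_nonneg hk (posLog_nonneg (frobNorm M⁻¹))
  have e3 := le_abs_self (Real.log ((n : ℝ) ^ k))
  have e4 := le_abs_self
    (Real.log (Fintype.card {s : Finset (Fin n) // s.card = k} * k.factorial))
  rw [logSize, abs_le]
  constructor <;> linarith

theorem stdIncl_transpose_mul_self {n k : ℕ} (hkn : k ≤ n) :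
    (stdIncl n k)ᵀ * stdIncl n k = 1 := by
  have h : stdIncl n k = (1 : Matrix (Fin n) (Fin n) ℝ).submatrix id (Fin.castLE hkn) := by
    ext i j
    simp [stdIncl, Matrix.one_apply, Fin.ext_iff]
  ext i j
  simp [h, Matrix.mul_apply, Matrix.one_apply]

theorem orthogonal_mul_stdIncl_gram {n k : ℕ} (hkn : k ≤ n)
    (U : Matrix.orthogonalGroup (Fin n) ℝ) :
    ((U : Matrix (Fin n) (Fin n) ℝ) * stdIncl n k)ᵀ *
      ((U : Matrix (Fin n) (Fin n) ℝ) * stdIncl n k) = 1 := by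
  rw [gram_orthogonal_mul, stdIncl_transpose_mul_self hkn]

/-- A left-invariant probability measure on a group is right-invariant. -/
theorem map_mul_right_eq_of_map_mul_left_eq {G : Type*} [Group G] [MeasurableSpace G]
    [MeasurableMul₂ G] [MeasurableInv G] (m : Measure G) [IsProbabilityMeasure m]
    (hm : ∀ g, m.map (fun x => g * x) = m) (g : G) : m.map (fun x => x * g) = m := by
  have : m.IsMulLeftInvariant := ⟨hm⟩
  have hinv : ∀ f : G → ENNReal, Measurable f → ∫⁻ x, f x⁻¹ ∂m = ∫⁻ x, f x ∂m := by
    intro f hf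
    calc ∫⁻ x, f x⁻¹ ∂m = ∫⁻ _y, ∫⁻ x, f x⁻¹ ∂m ∂m := by simp
      _ = ∫⁻ y, ∫⁻ x, f (x⁻¹ * y) ∂m ∂m := by
          refine lintegral_congr fun y => ?_
          rw [← lintegral_mul_left_eq_self (fun x => f x⁻¹) y⁻¹]
          simp
      _ = ∫⁻ x, ∫⁻ y, f (x⁻¹ * y) ∂m ∂m := by
          apply lintegral_lintegral_swap
          exact (hf.comp (measurable_snd.inv.mul measurable_fst)).aemeasurable
      _ = ∫⁻ _x, ∫⁻ y, f y ∂m ∂m :=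
          lintegral_congr fun x => lintegral_mul_left_eq_self f x⁻¹
      _ = _ := by simp
  refine Measure.ext_of_lintegral _ fun f hf => ?_
  rw [lintegral_map hf (measurable_mul_const g)]
  calc ∫⁻ x, f (x * g) ∂m = ∫⁻ x, f (x⁻¹ * g) ∂m :=
        (hinv (fun x => f (x * g)) (hf.comp (measurable_mul_const g))).symm
    _ = ∫⁻ x, f (g⁻¹ * x)⁻¹ ∂m := by simp
    _ = ∫⁻ x, f x⁻¹ ∂m := lintegral_mul_left_eq_self (fun x => f x⁻¹) g⁻¹
    _ = _ := hinv f hf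

/-- The reflection in the direction `u eᵢ + eⱼ`. -/
theorem exists_orthogonal_reflection {n : ℕ} {i j : Fin n} (hij : i ≠ j) (u : ℝ) :
    ∃ R : Matrix.orthogonalGroup (Fin n) ℝ, ∀ {k : ℕ} (X : Matrix (Fin n) (Fin k) ℝ),
      (∀ l, l ≠ i → l ≠ j → ((R : Matrix (Fin n) (Fin n) ℝ) * X) l = X l) ∧
      ((R : Matrix (Fin n) (Fin n) ℝ) * X) i =
        ((1 - u ^ 2) / (1 + u ^ 2)) • X i + (-(2 * u) / (1 + u ^ 2)) • X j ∧
      ((R : Matrix (Fin n) (Fin n) ℝ) * X) j =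
        (-(2 * u) / (1 + u ^ 2)) • X i + (-(1 - u ^ 2) / (1 + u ^ 2)) • X j := by
  classical
  have hu : 1 + u ^ 2 ≠ 0 := by positivity
  set v : Fin n → ℝ := u • Pi.single i 1 + Pi.single j 1 with hv
  have hvi : v i = u := by simp [hv, hij]
  have hvj : v j = 1 := by simp [hv, hij.symm]
  have hvl : ∀ l, l ≠ i → l ≠ j → v l = 0 := fun l h1 h2 => by simp [hv, h1, h2]
  have hvv : v ⬝ᵥ v = 1 + u ^ 2 := by
    simp [hv, dotProduct_add, hij, hij.symm]
    ring
  set R : Matrix (Fin n) (Fin n) ℝ := 1 - (2 / (1 + u ^ 2)) • vecMulVec v v with hR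
  have hRt : Rᵀ = R := by
    rw [hR, Matrix.transpose_sub, Matrix.transpose_smul, Matrix.transpose_vecMulVec,
      Matrix.transpose_one]
  have hRR : Rᵀ * R = 1 := by
    have hsq : vecMulVec v v * vecMulVec v v = (1 + u ^ 2) • vecMulVec v v := by
      rw [Matrix.vecMulVec_mul_vecMulVec, hvv]
      ext a b
      simp [vecMulVec_apply]
      ring
    rw [hRt, hR, Matrix.sub_mul, Matrix.mul_sub, Matrix.mul_sub, Matrix.one_mul, Matrix.mul_one,
      Matrix.one_mul, Matrix.smul_mul, Matrix.mul_smul, hsq, smul_smul, smul_smul]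
    ext a b
    simp only [Matrix.sub_apply, Matrix.smul_apply, smul_eq_mul]
    field_simp
    ring
  refine ⟨⟨R, (Matrix.mem_orthogonalGroup_iff' _ _).2 hRR⟩, fun {k} X => ?_⟩
  have hmul : ∀ l c, (R * X) l c = X l c - 2 / (1 + u ^ 2) * v l * (u * X i c + X j c) := by
    intro l c
    have : (vecMulVec v v * X) l c = v l * (u * X i c + X j c) := by
      rw [Matrix.vecMulVec_mul, vecMulVec_apply]
      congr 1
      simp [hv, add_vecMul, smul_vecMul]
    rw [hR, Matrix.sub_mul, Matrix.one_mul, Matrix.smul_mul, Matrix.sub_apply, Matrix.smul_apply,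
      this, smul_eq_mul, mul_assoc]
  refine ⟨fun l h1 h2 => ?_, ?_, ?_⟩
  · ext c
    rw [hmul, hvl l h1 h2]
    ring
  · ext c
    rw [hmul, hvi]
    simp only [Pi.add_apply, Pi.smul_apply, smul_eq_mul]
    field_simp
    ring
  · ext c
    rw [hmul, hvj]
    simp only [Pi.add_apply, Pi.smul_apply, smul_eq_mul]
    field_simp
    ring

/-- The minor of the first `k` columns of `U` with rows selected by `f`. -/
def frameMinor {n k : ℕ} (f : Fin k → Fin n) (U : Matrix.orthogonalGroup (Fin n) ℝ) : ℝ :=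
  (((U : Matrix (Fin n) (Fin n) ℝ) * stdIncl n k).submatrix f id).det

theorem continuous_frameMinor {n k : ℕ} (f : Fin k → Fin n) :
    Continuous (frameMinor (n := n) (k := k) f) := by
  unfold frameMinor
  fun_prop

theorem frameMinor_eq_zero_of_not_injective {n k : ℕ} {f : Fin k → Fin n}
    (hf : ¬ Function.Injective f) (U : Matrix.orthogonalGroup (Fin n) ℝ) :
    frameMinor f U = 0 := by
  obtain ⟨a, b, hab, hne⟩ := Function.not_injective_iff.1 hf
  exact Matrix.det_zero_of_row_eq hne (by ext j; simp [hab])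

theorem measure_frameMinor_exchange {n k : ℕ}
    [MeasurableSpace (Matrix.orthogonalGroup (Fin n) ℝ)]
    [BorelSpace (Matrix.orthogonalGroup (Fin n) ℝ)]
    (νO : Measure (Matrix.orthogonalGroup (Fin n) ℝ)) [IsProbabilityMeasure νO]
    (hνO : ∀ U : Matrix.orthogonalGroup (Fin n) ℝ, νO.map (fun V => U * V) = νO)
    {f : Fin k → Fin n} (hf : Function.Injective f) (t : Fin k) {j : Fin n}
    (hj : ∀ l, f l ≠ j) :
    νO {U | frameMinor f U = 0 ∧ frameMinor (Function.update f t j) U ≠ 0} = 0 := by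
  classical
  set Z := {U | frameMinor f U = 0 ∧ frameMinor (Function.update f t j) U ≠ 0} with hZ
  have hZm : MeasurableSet Z :=
    ((isClosed_singleton (x := (0 : ℝ))).preimage (continuous_frameMinor f)).measurableSet.inter
      ((isClosed_singleton (x := (0 : ℝ))).preimage
        (continuous_frameMinor (Function.update f t j))).measurableSet.compl
  choose R hR using fun m : ℕ => exists_orthogonal_reflection (hj t) ((m : ℝ) + 1)
  have hp : ∀ (m : ℕ) (U : Matrix.orthogonalGroup (Fin n) ℝ),
      frameMinor f (R m * U) =
        ((1 - ((m : ℝ) + 1) ^ 2) / (1 + ((m : ℝ) + 1) ^ 2)) * frameMinor f U +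
        (-(2 * ((m : ℝ) + 1)) / (1 + ((m : ℝ) + 1) ^ 2)) *
          frameMinor (Function.update f t j) U ∧
      frameMinor (Function.update f t j) (R m * U) =
        (-(2 * ((m : ℝ) + 1)) / (1 + ((m : ℝ) + 1) ^ 2)) * frameMinor f U +
        (-(1 - ((m : ℝ) + 1) ^ 2) / (1 + ((m : ℝ) + 1) ^ 2)) *
          frameMinor (Function.update f t j) U := by
    intro m U
    obtain ⟨h1, h2, h3⟩ := hR m ((U : Matrix (Fin n) (Fin n) ℝ) * stdIncl n k)
    set X := (U : Matrix (Fin n) (Fin n) ℝ) * stdIncl n k with hX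
    have hrow : ∀ i, (((R m * U : Matrix.orthogonalGroup (Fin n) ℝ) :
        Matrix (Fin n) (Fin n) ℝ) * stdIncl n k).submatrix (Function.update f t i) id =
        (X.submatrix f id).updateRow t (((R m : Matrix (Fin n) (Fin n) ℝ) * X) i) := by
      intro i
      rw [Submonoid.coe_mul, Matrix.mul_assoc, ← hX]
      ext a b
      by_cases ha : a = t
      · subst ha
        rw [Matrix.updateRow_self, Matrix.submatrix_apply, Function.update_self]; rfl
      · rw [Matrix.updateRow_ne ha, Matrix.submatrix_apply, Matrix.submatrix_apply,
          Function.update_of_ne ha, h1 (f a) (fun h => ha (hf h)) (hj a)]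
    have e2 : X.submatrix (Function.update f t j) id = (X.submatrix f id).updateRow t (X j) := by
      ext a b
      by_cases ha : a = t
      · subst ha
        rw [Matrix.updateRow_self]; simp
      · rw [Matrix.updateRow_ne ha]; simp [ha]
    have e3 : (X.submatrix f id).updateRow t (X (f t)) = X.submatrix f id :=
      Matrix.updateRow_eq_self _ t
    have e4 := hrow (f t)
    rw [Function.update_eq_self] at e4
    unfold frameMinor
    rw [e4, hrow j, ← hX, e2, h2, h3]
    simp only [Matrix.det_updateRow_add, Matrix.det_updateRow_smul, e3, and_self]
  have hdisj : Pairwise (Function.onFun Disjoint fun m : ℕ => (fun V => R m * V) ⁻¹' Z) := by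
    intro a b hab
    rw [Function.onFun, Set.disjoint_left]
    intro U hUa hUb
    obtain ⟨ha1, ha2⟩ := hp a U
    obtain ⟨hb1, -⟩ := hp b U
    have ha : frameMinor f (R a * U) = 0 := hUa.1
    have hb : frameMinor f (R b * U) = 0 := hUb.1
    apply hUa.2
    change frameMinor (Function.update f t j) (R a * U) = 0
    rw [ha] at ha1
    rw [hb] at hb1
    rw [ha2]
    generalize frameMinor f U = p at *
    generalize frameMinor (Function.update f t j) U = q at *
    have hab' : (a : ℝ) - b ≠ 0 := sub_ne_zero.2 (by exact_mod_cast hab)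
    have hu : (0 : ℝ) < (a : ℝ) + 1 := by positivity
    have hw : (0 : ℝ) < (b : ℝ) + 1 := by positivity
    have hd : (a : ℝ) + 1 - ((b : ℝ) + 1) ≠ 0 := by simpa using hab'
    generalize (a : ℝ) + 1 = u at *
    generalize (b : ℝ) + 1 = w at *
    have hu2 : 1 + u ^ 2 ≠ 0 := by positivity
    have hw2 : 1 + w ^ 2 ≠ 0 := by positivity
    have huw : 1 + u * w ≠ 0 := by positivity
    field_simp at ha1 hb1
    have hp0 : p = 0 := by
      have h : (u - w) * (1 + u * w) * p = 0 := by linear_combination w * ha1 - u * hb1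
      simpa [hd, huw] using h
    have hq0 : q = 0 := by
      rw [hp0] at ha1
      have h : u * q = 0 := by linear_combination (1 / 2) * ha1
      simpa [hu.ne'] using h
    rw [hp0, hq0]
    ring
  have hmeas : ∀ m, νO ((fun V => R m * V) ⁻¹' Z) = νO Z := fun m => by
    conv_rhs => rw [← hνO (R m)]
    rw [Measure.map_apply (by fun_prop) hZm]
  by_contra hne
  have hsum := tsum_measure_le_measure_univ (μ := νO)
    (s := fun m : ℕ => (fun V => R m * V) ⁻¹' Z)
    (fun m => ((by fun_prop : Measurable fun V => R m * V) hZm).nullMeasurableSet)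
    (fun a b hab => (hdisj hab).aedisjoint)
  simp only [hmeas, ENNReal.tsum_const_eq_top_of_ne_zero hne, measure_univ] at hsum
  simp at hsum

theorem sum_frameMinor_sq {n k : ℕ} (hkn : k ≤ n) (U : Matrix.orthogonalGroup (Fin n) ℝ) :
    ∑ f : Fin k → Fin n, frameMinor f U ^ 2 = k.factorial := by
  unfold frameMinor
  rw [← factorial_mul_det_transpose_mul_self, orthogonal_mul_stdIncl_gram hkn]
  simp

theorem measure_frameMinor_eq_zero {n k : ℕ} (hkn : k ≤ n)
    [MeasurableSpace (Matrix.orthogonalGroup (Fin n) ℝ)]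
    [BorelSpace (Matrix.orthogonalGroup (Fin n) ℝ)]
    (νO : Measure (Matrix.orthogonalGroup (Fin n) ℝ)) [IsProbabilityMeasure νO]
    (hνO : ∀ U : Matrix.orthogonalGroup (Fin n) ℝ, νO.map (fun V => U * V) = νO)
    {f₀ : Fin k → Fin n} (hf₀ : Function.Injective f₀) :
    νO {U | frameMinor f₀ U = 0} = 0 := by
  classical
  have chain : ∀ (s : ℕ) (f : Fin k → Fin n), (∀ l : Fin k, s ≤ l → f l = f₀ l) →
      νO {U | frameMinor f₀ U = 0 ∧ frameMinor f U ≠ 0} = 0 := by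
    intro s
    induction s with
    | zero =>
      intro f hf
      obtain rfl : f = f₀ := funext fun l => hf l (Nat.zero_le _)
      simp
    | succ s ih =>
      intro f hf
      by_cases hs : s < k
      swap
      · exact ih f fun l hl => absurd (hl.trans_lt l.2) hs
      let t : Fin k := ⟨s, hs⟩
      have hgt : ∀ l : Fin k, s ≤ l → l ≠ t → f l = f₀ l := fun l hl hlt =>
        hf l (Nat.succ_le_of_lt (lt_of_le_of_ne hl fun h => hlt (Fin.ext h.symm)))
      by_cases hinj : Function.Injective f
      swap
      · simp [frameMinor_eq_zero_of_not_injective hinj]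
      by_cases hmem : ∃ i, f i = f₀ t
      · obtain ⟨i, hi⟩ := hmem
        have hit : (i : ℕ) ≤ s := by
          by_contra h
          have h1 := hf i (by omega)
          rw [hi] at h1
          have := congrArg Fin.val (hf₀ h1)
          simp only [t] at this
          omega
        have hswap : ∀ U, frameMinor (f ∘ Equiv.swap i t) U =
            ((Equiv.Perm.sign (Equiv.swap i t) : ℤ) : ℝ) * frameMinor f U := fun U =>
          Matrix.det_permute (Equiv.swap i t)
            (((U : Matrix (Fin n) (Fin n) ℝ) * stdIncl n k).submatrix f id)
        have hnull := ih (f ∘ Equiv.swap i t) fun l hl => by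
          by_cases hlt : l = t
          · rw [hlt, Function.comp, Equiv.swap_apply_right, hi]
          · have hli : l ≠ i := by
              rintro rfl
              exact hlt (Fin.ext (le_antisymm hit hl))
            rw [Function.comp, Equiv.swap_apply_of_ne_of_ne hli hlt, hgt l hl hlt]
        refine measure_mono_null ?_ hnull
        intro U hU
        refine ⟨hU.1, ?_⟩
        rw [hswap]
        exact mul_ne_zero (by exact_mod_cast (Equiv.Perm.sign (Equiv.swap i t)).ne_zero) hU.2
      · push Not at hmem
        set f' := Function.update f t (f₀ t) with hf'
        have hf't : f' t = f₀ t := by simp [hf']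
        have hf'l : ∀ l, l ≠ t → f' l = f l := fun l hl => by simp [hf', hl]
        have hinj' : Function.Injective f' := by
          intro a b hab
          by_cases ha : a = t <;> by_cases hb : b = t
          · rw [ha, hb]
          · rw [ha, hf't, hf'l b hb] at hab
            exact absurd hab.symm (hmem b)
          · rw [hb, hf't, hf'l a ha] at hab
            exact absurd hab (hmem a)
          · rw [hf'l a ha, hf'l b hb] at hab
            exact hinj hab
        have hnot : ∀ l, f' l ≠ f t := by
          intro l
          by_cases hl : l = t
          · rw [hl, hf't]
            exact (hmem t).symm
          · rw [hf'l l hl]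
            exact fun h => hl (hinj h)
        have hback : Function.update f' t (f t) = f := by simp [hf']
        have h1 := measure_frameMinor_exchange νO hνO hinj' t hnot
        rw [hback] at h1
        have h2 := ih f' fun l hl => by
          by_cases hlt : l = t
          · rw [hlt, hf't]
          · rw [hf'l l hlt, hgt l hl hlt]
        refine measure_mono_null (fun U hU => ?_) (measure_union_null h1 h2)
        by_cases h : frameMinor f' U = 0
        · exact Or.inl ⟨h, hU.2⟩
        · exact Or.inr ⟨hU.1, h⟩
  refine measure_mono_null (fun U hU => ?_) (measure_iUnion_null fun f =>
    chain k f fun l hl => absurd l.2 (not_lt.2 hl))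
  have hex : ∃ f : Fin k → Fin n, frameMinor f U ≠ 0 := by
    by_contra! h
    have hsum := sum_frameMinor_sq hkn U
    simp only [h] at hsum
    have := one_le_factorial_cast k
    simp at hsum
    linarith
  obtain ⟨f, hf⟩ := hex
  exact Set.mem_iUnion.2 ⟨f, hU, hf⟩

/-- Minors of a Haar-random frame are uniformly unlikely to be small. -/
theorem exists_measure_abs_frameMinor_le {n k : ℕ} (hkn : k ≤ n)
    [MeasurableSpace (Matrix.orthogonalGroup (Fin n) ℝ)]
    [BorelSpace (Matrix.orthogonalGroup (Fin n) ℝ)]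
    (νO : Measure (Matrix.orthogonalGroup (Fin n) ℝ)) [IsProbabilityMeasure νO]
    (hνO : ∀ U : Matrix.orthogonalGroup (Fin n) ℝ, νO.map (fun V => U * V) = νO)
    {ε : ℝ} (hε : 0 < ε) :
    ∃ δ : ℝ, 0 < δ ∧ ∀ f : Fin k → Fin n, Function.Injective f →
      νO.real {U | |frameMinor f U| ≤ δ} ≤ ε := by
  have hev : ∀ f : Fin k → Fin n, ∀ᶠ m : ℕ in atTop, Function.Injective f →
      νO.real {U | |frameMinor f U| ≤ 1 / ((m : ℝ) + 1)} ≤ ε := by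
    intro f
    by_cases hf : Function.Injective f
    swap
    · exact Eventually.of_forall fun m h => absurd h hf
    have hmeas : ∀ m : ℕ, MeasurableSet {U | |frameMinor f U| ≤ 1 / ((m : ℝ) + 1)} := fun m =>
      (isClosed_le (continuous_frameMinor f).abs continuous_const).measurableSet
    have hlim := tendsto_measure_iInter_atTop (μ := νO)
      (s := fun m : ℕ => {U | |frameMinor f U| ≤ 1 / ((m : ℝ) + 1)})
      (fun m => (hmeas m).nullMeasurableSet)
      (fun a b hab U (hU : |frameMinor f U| ≤ 1 / ((b : ℝ) + 1)) =>
        show |frameMinor f U| ≤ 1 / ((a : ℝ) + 1) from hU.trans (Nat.one_div_le_one_div hab))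
      ⟨0, measure_ne_top _ _⟩
    have hinter : ⋂ m : ℕ, {U | |frameMinor f U| ≤ 1 / ((m : ℝ) + 1)} =
        {U | frameMinor f U = 0} := by
      ext U
      simp only [Set.mem_iInter, Set.mem_ofPred_eq]
      constructor
      · intro h
        have := ge_of_tendsto' (tendsto_one_div_add_atTop_nhds_zero_nat (𝕜 := ℝ)) h
        exact abs_eq_zero.1 (le_antisymm this (abs_nonneg _))
      · intro h m
        rw [h, abs_zero]
        positivity
    rw [hinter, measure_frameMinor_eq_zero hkn νO hνO hf] at hlim
    filter_upwards [hlim.eventually_le_const (ENNReal.ofReal_pos.2 hε)] with m hm _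
    exact ENNReal.toReal_le_of_le_ofReal hε.le hm
  obtain ⟨m, hm⟩ := (eventually_all.2 hev).exists
  exact ⟨1 / ((m : ℝ) + 1), by positivity, hm⟩

/-- The span of the first `k` columns of a matrix is a rotation of the standard `k`-plane. -/
theorem exists_orthogonal_mul_stdIncl {n k : ℕ} (hkn : k ≤ n) (N : Matrix (Fin n) (Fin n) ℝ) :
    ∃ (V : Matrix.orthogonalGroup (Fin n) ℝ) (T : Matrix (Fin k) (Fin k) ℝ),
      N * stdIncl n k = (V : Matrix (Fin n) (Fin n) ℝ) * stdIncl n k * T := by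
  classical
  let f : Fin n → EuclideanSpace ℝ (Fin n) := fun j => WithLp.toLp 2 (fun i => N i j)
  let b := InnerProductSpace.gramSchmidtOrthonormalBasis
    (𝕜 := ℝ) (E := EuclideanSpace ℝ (Fin n)) (ι := Fin n) (by simp) f
  let V : Matrix (Fin n) (Fin n) ℝ := fun i j => b j i
  let R : Matrix (Fin n) (Fin n) ℝ := fun j l => inner ℝ (b j) (f l)
  have hVb : ∀ i j, V i j = b j i := fun _ _ => rfl
  have hRb : ∀ j l, R j l = inner ℝ (b j) (f l) := fun _ _ => rfl
  have hV : Vᵀ * V = 1 := by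
    ext j l
    have h := orthonormal_iff_ite.1 b.orthonormal l j
    rw [PiLp.inner_apply] at h
    simp only [Matrix.mul_apply, Matrix.transpose_apply, Matrix.one_apply, hVb]
    simp only [RCLike.inner_apply, conj_trivial] at h
    rw [h]
    simp [eq_comm]
  have hN : N = V * R := by
    ext i l
    have h := congrArg (fun x : EuclideanSpace ℝ (Fin n) => x i) (b.sum_repr (f l))
    simp only [OrthonormalBasis.repr_apply_apply, WithLp.ofLp_sum, WithLp.ofLp_smul,
      Finset.sum_apply, Pi.smul_apply, smul_eq_mul] at h
    rw [Matrix.mul_apply]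
    simp only [hVb, hRb]
    rw [Finset.sum_congr rfl fun j _ => mul_comm _ _, h]
  have hR : ∀ j l, l < j → R j l = 0 := fun j l h =>
    InnerProductSpace.gramSchmidtOrthonormalBasis_inv_triangular _ f h
  refine ⟨⟨V, (Matrix.mem_orthogonalGroup_iff' _ _).2 hV⟩,
    R.submatrix (Fin.castLE hkn) (Fin.castLE hkn), ?_⟩
  have hι : stdIncl n k = (1 : Matrix (Fin n) (Fin n) ℝ).submatrix id (Fin.castLE hkn) := by
    ext i j
    simp [stdIncl, Matrix.one_apply, Fin.ext_iff]
  have hRι : R * stdIncl n k =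
      stdIncl n k * R.submatrix (Fin.castLE hkn) (Fin.castLE hkn) := by
    ext i l
    have h1 : (R * stdIncl n k) i l = R i (Fin.castLE hkn l) := by
      rw [hι]
      simp [Matrix.mul_apply, Matrix.one_apply]
    rw [h1, Matrix.mul_apply]
    by_cases hi : (i : ℕ) < k
    · rw [Finset.sum_eq_single ⟨i, hi⟩]
      · simp [stdIncl]
      · intro j _ hj
        have : (i : ℕ) ≠ j := fun h => hj (Fin.ext h.symm)
        simp [stdIncl, this]
      · simp
    · rw [Finset.sum_eq_zero]
      · exact hR _ _ (show (l : ℕ) < i from lt_of_lt_of_le l.2 (not_lt.1 hi))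
      · intro j _
        have : (i : ℕ) ≠ j := fun h => hi (h ▸ j.2)
        simp [stdIncl, this]
  rw [hN, Matrix.mul_assoc, hRι, ← Matrix.mul_assoc]

/-- The additive constant in the bound of `gramLog` by `logSize`. -/
def gramLogConst (n k : ℕ) : ℝ :=
  |Real.log ((n : ℝ) ^ k)| +
    |Real.log (Fintype.card {s : Finset (Fin n) // s.card = k} * k.factorial)|

theorem measurable_gramLog_comp {α : Type*} [TopologicalSpace α] [MeasurableSpace α]
    [OpensMeasurableSpace α] {n k : ℕ} {φ : α → Matrix (Fin n) (Fin k) ℝ} (hφ : Continuous φ) :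
    Measurable fun a => gramLog (φ a) := by
  unfold gramLog
  exact (Real.continuous_sqrt.comp
    (hφ.matrix_transpose.matrix_mul hφ).matrix_det).measurable.log

theorem abs_gramLog_frame_le {n k : ℕ} (hkn : k ≤ n) {A : Matrix (Fin n) (Fin n) ℝ}
    (hA : IsUnit A.det) (U : Matrix.orthogonalGroup (Fin n) ℝ) :
    |gramLog (A * (U : Matrix (Fin n) (Fin n) ℝ) * stdIncl n k)| ≤
      gramLogConst n k + k * logSize A := by
  rw [Matrix.mul_assoc]
  exact abs_gramLog_mul_le hA (orthogonal_mul_stdIncl_gram hkn U)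

theorem gramLog_mul_right {n k : ℕ} {Y : Matrix (Fin n) (Fin k) ℝ} (hY : (Yᵀ * Y).det ≠ 0)
    {T : Matrix (Fin k) (Fin k) ℝ} (hT : T.det ≠ 0) :
    gramLog (Y * T) = gramLog Y + Real.log |T.det| := by
  have h : ((Y * T)ᵀ * (Y * T)).det = (Yᵀ * Y).det * T.det ^ 2 := by
    have : (Y * T)ᵀ * (Y * T) = Tᵀ * (Yᵀ * Y) * T := by
      rw [Matrix.transpose_mul]
      simp only [Matrix.mul_assoc]
    rw [this, Matrix.det_mul, Matrix.det_mul, Matrix.det_transpose]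
    ring
  have hpos := lt_of_le_of_ne (det_transpose_mul_self_nonneg Y) hY.symm
  unfold gramLog
  rw [h, Real.sqrt_mul hpos.le, Real.sqrt_sq_eq_abs,
    Real.log_mul (Real.sqrt_pos.2 hpos).ne' (abs_pos.2 hT).ne']

theorem isUnit_det_mul_orthogonal {n : ℕ} {A : Matrix (Fin n) (Fin n) ℝ} (hA : IsUnit A.det)
    (U : Matrix.orthogonalGroup (Fin n) ℝ) :
    IsUnit (A * (U : Matrix (Fin n) (Fin n) ℝ)).det := by
  rw [Matrix.det_mul]
  exact hA.mul (isUnit_det_orthogonal U)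

theorem secondCountableTopology_matrix (n : ℕ) :
    SecondCountableTopology (Matrix (Fin n) (Fin n) ℝ) :=
  inferInstanceAs (SecondCountableTopology (Fin n → Fin n → ℝ))

theorem secondCountableTopology_orthogonalGroup (n : ℕ) :
    SecondCountableTopology (Matrix.orthogonalGroup (Fin n) ℝ) :=
  have := secondCountableTopology_matrix n
  TopologicalSpace.Subtype.secondCountableTopology _

section

variable {n : ℕ} [MeasurableSpace (Matrix.orthogonalGroup (Fin n) ℝ)]

/-- The average over the Grassmannian of the logarithmic volume distortion of `A`. -/
def avgGramLog (νO : Measure (Matrix.orthogonalGroup (Fin n) ℝ)) (k : ℕ)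
    (A : Matrix (Fin n) (Fin n) ℝ) : ℝ :=
  ∫ U : Matrix.orthogonalGroup (Fin n) ℝ,
    gramLog (A * (U : Matrix (Fin n) (Fin n) ℝ) * stdIncl n k) ∂νO

theorem abs_avgGramLog_le (νO : Measure (Matrix.orthogonalGroup (Fin n) ℝ))
    [IsProbabilityMeasure νO] {k : ℕ} (hkn : k ≤ n) {A : Matrix (Fin n) (Fin n) ℝ}
    (hA : IsUnit A.det) : |avgGramLog νO k A| ≤ gramLogConst n k + k * logSize A := by
  have h := norm_integral_le_of_norm_le_const (μ := νO)
    (f := fun U : Matrix.orthogonalGroup (Fin n) ℝ =>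
      gramLog (A * (U : Matrix (Fin n) (Fin n) ℝ) * stdIncl n k))
    (Eventually.of_forall fun U => (Real.norm_eq_abs _).trans_le (abs_gramLog_frame_le hkn hA U))
  simpa [avgGramLog] using h

variable [BorelSpace (Matrix.orthogonalGroup (Fin n) ℝ)]

theorem integrable_gramLog_frame (νO : Measure (Matrix.orthogonalGroup (Fin n) ℝ))
    [IsProbabilityMeasure νO] {k : ℕ} (hkn : k ≤ n) {A : Matrix (Fin n) (Fin n) ℝ}
    (hA : IsUnit A.det) :
    Integrable (fun U : Matrix.orthogonalGroup (Fin n) ℝ =>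
      gramLog (A * (U : Matrix (Fin n) (Fin n) ℝ) * stdIncl n k)) νO :=
  Integrable.of_bound (measurable_gramLog_comp (by fun_prop)).aestronglyMeasurable _
    (Eventually.of_forall fun U => abs_gramLog_frame_le hkn hA U)

/-- The averaged distortion does not depend on the plane that is being rotated. -/
theorem integral_gramLog_rotate (νO : Measure (Matrix.orthogonalGroup (Fin n) ℝ))
    [IsProbabilityMeasure νO]
    (hνO : ∀ U : Matrix.orthogonalGroup (Fin n) ℝ, νO.map (fun V => U * V) = νO)
    {k : ℕ} (hkn : k ≤ n) {A N : Matrix (Fin n) (Fin n) ℝ} (hA : IsUnit A.det)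
    (hN : IsUnit N.det) :
    ∫ W : Matrix.orthogonalGroup (Fin n) ℝ,
      gramLog (A * (W : Matrix (Fin n) (Fin n) ℝ) * (N * stdIncl n k)) ∂νO =
      avgGramLog νO k A + gramLog (N * stdIncl n k) := by
  have := secondCountableTopology_orthogonalGroup n
  obtain ⟨V, T, hVT⟩ := exists_orthogonal_mul_stdIncl hkn N
  have hpos : ∀ {M : Matrix (Fin n) (Fin n) ℝ}, IsUnit M.det →
      0 < ((M * stdIncl n k)ᵀ * (M * stdIncl n k)).det := fun hM =>
    det_gram_mul_pos hM (by rw [stdIncl_transpose_mul_self hkn]; simp)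
  have hT : T.det ≠ 0 := by
    intro h0
    have h := hpos hN
    rw [hVT, Matrix.transpose_mul, Matrix.mul_assoc, Matrix.det_mul, Matrix.det_transpose, h0,
      zero_mul] at h
    exact lt_irrefl _ h
  have hNT : gramLog (N * stdIncl n k) = Real.log |T.det| := by
    rw [hVT, gramLog_mul_right (hpos (isUnit_det_orthogonal V)).ne' hT]
    unfold gramLog
    rw [orthogonal_mul_stdIncl_gram hkn]
    simp
  have hW : ∀ W : Matrix.orthogonalGroup (Fin n) ℝ,
      gramLog (A * (W : Matrix (Fin n) (Fin n) ℝ) * (N * stdIncl n k)) =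
      gramLog (A * ((W * V : Matrix.orthogonalGroup (Fin n) ℝ) : Matrix (Fin n) (Fin n) ℝ) *
        stdIncl n k) + gramLog (N * stdIncl n k) := by
    intro W
    rw [hNT, ← gramLog_mul_right (hpos (isUnit_det_mul_orthogonal hA (W * V))).ne' hT, hVT]
    simp only [Submonoid.coe_mul, Matrix.mul_assoc]
  have hright := map_mul_right_eq_of_map_mul_left_eq νO hνO V
  have hint := integrable_gramLog_frame νO hkn hA
  have hmp : MeasurePreserving (fun W => W * V) νO νO := ⟨by fun_prop, hright⟩
  have hcomp : Integrable (fun W : Matrix.orthogonalGroup (Fin n) ℝ =>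
      gramLog (A * ((W * V : Matrix.orthogonalGroup (Fin n) ℝ) : Matrix (Fin n) (Fin n) ℝ) *
        stdIncl n k)) νO :=
    hmp.integrable_comp_of_integrable
      (g := fun U : Matrix.orthogonalGroup (Fin n) ℝ =>
        gramLog (A * (U : Matrix (Fin n) (Fin n) ℝ) * stdIncl n k)) hint
  simp_rw [hW]
  rw [integral_add hcomp (integrable_const _), integral_const]
  simp only [probReal_univ, one_smul]
  congr 1
  unfold avgGramLog
  conv_rhs => rw [← hright]
  rw [integral_map (by fun_prop) (by rw [hright]; exact hint.aestronglyMeasurable)]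

variable [MeasurableSpace (Matrix (Fin n) (Fin n) ℝ)] [BorelSpace (Matrix (Fin n) (Fin n) ℝ)]

theorem measurable_avgGramLog (νO : Measure (Matrix.orthogonalGroup (Fin n) ℝ))
    [IsProbabilityMeasure νO] (k : ℕ) : Measurable (avgGramLog νO k) := by
  have := secondCountableTopology_matrix n
  have h : Measurable fun p : Matrix (Fin n) (Fin n) ℝ × Matrix.orthogonalGroup (Fin n) ℝ =>
      gramLog (p.1 * (p.2 : Matrix (Fin n) (Fin n) ℝ) * stdIncl n k) :=
    measurable_gramLog_comp (by fun_prop)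
  exact h.stronglyMeasurable.integral_prod_right'.measurable

/-- Averaging the distortion of `B A` over a left-invariant law for `A` splits additively. -/
theorem integral_avgGramLog_mul (νO : Measure (Matrix.orthogonalGroup (Fin n) ℝ))
    [IsProbabilityMeasure νO]
    (hνO : ∀ U : Matrix.orthogonalGroup (Fin n) ℝ, νO.map (fun V => U * V) = νO)
    (ν : Measure (Matrix (Fin n) (Fin n) ℝ)) [IsProbabilityMeasure ν]
    (hGL : ∀ᵐ A ∂ν, IsUnit A.det)
    (hOinv : ∀ U : Matrix.orthogonalGroup (Fin n) ℝ,
      ν.map (fun A => (U : Matrix (Fin n) (Fin n) ℝ) * A) = ν)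
    (hint : Integrable logSize ν)
    {k : ℕ} (hkn : k ≤ n) {B : Matrix (Fin n) (Fin n) ℝ} (hB : IsUnit B.det) :
    ∫ A, avgGramLog νO k (B * A) ∂ν = avgGramLog νO k B + ∫ A, avgGramLog νO k A ∂ν := by
  have := secondCountableTopology_orthogonalGroup n
  have := secondCountableTopology_matrix n
  have hmeas := measurable_avgGramLog νO k
  have hBm : Measurable fun A : Matrix (Fin n) (Fin n) ℝ => B * A :=
    (by fun_prop : Continuous fun A : Matrix (Fin n) (Fin n) ℝ => B * A).measurable
  have hrot : ∀ W : Matrix.orthogonalGroup (Fin n) ℝ, ∫ A, avgGramLog νO k (B * A) ∂ν =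
      ∫ A, avgGramLog νO k (B * ((W : Matrix (Fin n) (Fin n) ℝ) * A)) ∂ν := by
    intro W
    have hWm : Measurable fun A : Matrix (Fin n) (Fin n) ℝ =>
        (W : Matrix (Fin n) (Fin n) ℝ) * A :=
      (by fun_prop : Continuous fun A : Matrix (Fin n) (Fin n) ℝ =>
        (W : Matrix (Fin n) (Fin n) ℝ) * A).measurable
    conv_lhs => rw [← hOinv W]
    rw [integral_map (f := fun A => avgGramLog νO k (B * A)) hWm.aemeasurable
      (hmeas.comp hBm).aestronglyMeasurable]
  have hprod : Integrable (Function.uncurry fun (W : Matrix.orthogonalGroup (Fin n) ℝ)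
      (A : Matrix (Fin n) (Fin n) ℝ) =>
      avgGramLog νO k (B * ((W : Matrix (Fin n) (Fin n) ℝ) * A))) (νO.prod ν) := by
    have hg : Integrable (fun p : Matrix.orthogonalGroup (Fin n) ℝ × Matrix (Fin n) (Fin n) ℝ =>
        gramLogConst n k + k * (logSize B + logSize p.2)) (νO.prod ν) :=
      (integrable_const _).add (((integrable_const _).add (hint.comp_snd νO)).const_mul _)
    refine hg.mono' ?_ ?_
    · have hc : Continuous fun p : Matrix.orthogonalGroup (Fin n) ℝ × Matrix (Fin n) (Fin n) ℝ =>
          B * ((p.1 : Matrix (Fin n) (Fin n) ℝ) * p.2) := by fun_prop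
      exact (hmeas.comp hc.measurable).aestronglyMeasurable
    · filter_upwards [Measure.quasiMeasurePreserving_snd.ae hGL] with p hp
      have hu : IsUnit (B * ((p.1 : Matrix (Fin n) (Fin n) ℝ) * p.2)).det := by
        rw [Matrix.det_mul, Matrix.det_mul]
        exact hB.mul ((isUnit_det_orthogonal _).mul hp)
      refine (abs_avgGramLog_le νO hkn hu).trans ?_
      have h := logSize_mul_le B ((p.1 : Matrix (Fin n) (Fin n) ℝ) * p.2)
      rw [logSize_orthogonal_mul] at h
      gcongr
  have hinner : ∀ A : Matrix (Fin n) (Fin n) ℝ, IsUnit A.det →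
      ∫ W : Matrix.orthogonalGroup (Fin n) ℝ,
        avgGramLog νO k (B * ((W : Matrix (Fin n) (Fin n) ℝ) * A)) ∂νO =
      avgGramLog νO k B + avgGramLog νO k A := by
    intro A hA
    have hWU : Integrable (Function.uncurry fun (W U : Matrix.orthogonalGroup (Fin n) ℝ) =>
        gramLog (B * ((W : Matrix (Fin n) (Fin n) ℝ) * A) * (U : Matrix (Fin n) (Fin n) ℝ) *
          stdIncl n k)) (νO.prod νO) := by
      refine Integrable.of_bound (C := gramLogConst n k + k * (logSize B + logSize A))
        (measurable_gramLog_comp (by fun_prop)).aestronglyMeasurable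
        (Eventually.of_forall fun p => ?_)
      have hu : IsUnit (B * ((p.1 : Matrix (Fin n) (Fin n) ℝ) * A)).det := by
        rw [Matrix.det_mul, Matrix.det_mul]
        exact hB.mul ((isUnit_det_orthogonal _).mul hA)
      refine (abs_gramLog_frame_le hkn hu p.2).trans ?_
      have h := logSize_mul_le B ((p.1 : Matrix (Fin n) (Fin n) ℝ) * A)
      rw [logSize_orthogonal_mul] at h
      gcongr
    calc ∫ W : Matrix.orthogonalGroup (Fin n) ℝ,
          avgGramLog νO k (B * ((W : Matrix (Fin n) (Fin n) ℝ) * A)) ∂νO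
        = ∫ U : Matrix.orthogonalGroup (Fin n) ℝ, ∫ W : Matrix.orthogonalGroup (Fin n) ℝ,
            gramLog (B * ((W : Matrix (Fin n) (Fin n) ℝ) * A) *
              (U : Matrix (Fin n) (Fin n) ℝ) * stdIncl n k) ∂νO ∂νO :=
          integral_integral_swap hWU
      _ = ∫ U : Matrix.orthogonalGroup (Fin n) ℝ, (avgGramLog νO k B +
            gramLog (A * (U : Matrix (Fin n) (Fin n) ℝ) * stdIncl n k)) ∂νO := by
          refine integral_congr_ae (Eventually.of_forall fun U => ?_)
          simp only
          rw [← integral_gramLog_rotate νO hνO hkn hB (isUnit_det_mul_orthogonal hA U)]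
          simp only [Matrix.mul_assoc]
      _ = _ := by
          rw [integral_add (integrable_const _) (integrable_gramLog_frame νO hkn hA)]
          simp [avgGramLog]
  have hint' : Integrable (avgGramLog νO k) ν := by
    refine ((integrable_const (gramLogConst n k)).add (hint.const_mul k)).mono'
      hmeas.aestronglyMeasurable ?_
    filter_upwards [hGL] with A hA
    exact abs_avgGramLog_le νO hkn hA
  calc ∫ A, avgGramLog νO k (B * A) ∂ν
      = ∫ _W : Matrix.orthogonalGroup (Fin n) ℝ, (∫ A, avgGramLog νO k (B * A) ∂ν) ∂νO := by
        simp
    _ = ∫ W : Matrix.orthogonalGroup (Fin n) ℝ,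
          ∫ A, avgGramLog νO k (B * ((W : Matrix (Fin n) (Fin n) ℝ) * A)) ∂ν ∂νO :=
        integral_congr_ae (Eventually.of_forall hrot)
    _ = ∫ A, ∫ W : Matrix.orthogonalGroup (Fin n) ℝ,
          avgGramLog νO k (B * ((W : Matrix (Fin n) (Fin n) ℝ) * A)) ∂νO ∂ν :=
        integral_integral_swap hprod
    _ = ∫ A, (avgGramLog νO k B + avgGramLog νO k A) ∂ν := by
        refine integral_congr_ae ?_
        filter_upwards [hGL] with A hA
        exact hinner A hA
    _ = _ := by
        rw [integral_add (integrable_const _) hint']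
        simp

end

theorem avgGramLog_le {n : ℕ}
    [MeasurableSpace (Matrix.orthogonalGroup (Fin n) ℝ)]
    [BorelSpace (Matrix.orthogonalGroup (Fin n) ℝ)]
    (νO : Measure (Matrix.orthogonalGroup (Fin n) ℝ)) [IsProbabilityMeasure νO]
    {k : ℕ} (hkn : k ≤ n) {M : Matrix (Fin n) (Fin n) ℝ} (hM : IsUnit M.det) :
    avgGramLog νO k M ≤
      Real.log ((n : ℝ) ^ k) + Real.log (frobNorm (compound k M)) := by
  have h : ∀ U : Matrix.orthogonalGroup (Fin n) ℝ,
      gramLog (M * (U : Matrix (Fin n) (Fin n) ℝ) * stdIncl n k) ≤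
      Real.log ((n : ℝ) ^ k) + Real.log (frobNorm (compound k M)) := by
    intro U
    have hU := orthogonal_mul_stdIncl_gram hkn U
    have h1 := gramLog_mul_le hM (X := (U : Matrix (Fin n) (Fin n) ℝ) * stdIncl n k)
      (by rw [hU]; simp)
    have h2 : gramLog ((U : Matrix (Fin n) (Fin n) ℝ) * stdIncl n k) = 0 := by
      unfold gramLog
      rw [hU]
      simp
    rw [h2, add_zero] at h1
    rwa [Matrix.mul_assoc]
  have h1 := integral_mono (integrable_gramLog_frame νO hkn hM) (integrable_const _) h
  simpa [avgGramLog] using h1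

theorem exists_abs_log_frobNorm_compound_sub_le {n : ℕ}
    [MeasurableSpace (Matrix.orthogonalGroup (Fin n) ℝ)]
    [BorelSpace (Matrix.orthogonalGroup (Fin n) ℝ)]
    (νO : Measure (Matrix.orthogonalGroup (Fin n) ℝ)) [IsProbabilityMeasure νO]
    (hνO : ∀ U : Matrix.orthogonalGroup (Fin n) ℝ, νO.map (fun V => U * V) = νO)
    {k : ℕ} (hkn : k ≤ n) {ε : ℝ} (hε : 0 < ε) :
    ∃ C : ℝ, ∀ M : Matrix (Fin n) (Fin n) ℝ, IsUnit M.det →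
      |Real.log (frobNorm (compound k M)) - avgGramLog νO k M| ≤ C + ε * logSize M := by
  have hε' : 0 < ε / (2 * k + 1) := by positivity
  obtain ⟨δ, hδ, hsmall⟩ := exists_measure_abs_frameMinor_le (k := k) hkn νO hνO hε'
  set c₁ := Real.log (Fintype.card {s : Finset (Fin n) // s.card = k} * k.factorial) with hc₁
  set c₂ := Real.log (Real.sqrt
    (((Fintype.card {s : Finset (Fin n) // s.card = k} : ℝ) * k.factorial) ^ 2 *
      k.factorial)) with hc₂
  set D := |c₁| + |c₂| + |Real.log δ| + gramLogConst n k with hD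
  refine ⟨D + |Real.log ((n : ℝ) ^ k)|, fun M hM => ?_⟩
  have hsize := logSize_nonneg M
  have hlow := avgGramLog_le νO hkn hM
  have hconst : 0 ≤ gramLogConst n k := by unfold gramLogConst; positivity
  have hD0 : 0 ≤ D := by positivity
  obtain ⟨K, f, hf, hK⟩ := exists_orthogonal_log_le hkn hM
  set S : Set (Matrix.orthogonalGroup (Fin n) ℝ) := {U | |frameMinor f (K * U)| ≤ δ} with hS
  have hmeasS : MeasurableSet S :=
    (isClosed_le (((continuous_frameMinor f).comp (continuous_const.mul continuous_id)).abs)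
      continuous_const).measurableSet
  have hνS : νO.real S ≤ ε / (2 * k + 1) := by
    refine le_trans (le_of_eq ?_) (hsmall f hf)
    have hm : MeasurableSet {U | |frameMinor f U| ≤ δ} :=
      (isClosed_le (continuous_frameMinor f).abs continuous_const).measurableSet
    have h := hνO K
    have hKm : Measurable fun V : Matrix.orthogonalGroup (Fin n) ℝ => K * V :=
      (continuous_const.mul continuous_id).measurable
    unfold Measure.real
    conv_rhs => rw [← h, Measure.map_apply hKm hm]
    rfl
  have hpt : ∀ U : Matrix.orthogonalGroup (Fin n) ℝ,
      Real.log (frobNorm (compound k M)) ≤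
        gramLog (M * (U : Matrix (Fin n) (Fin n) ℝ) * stdIncl n k) +
          (D + S.indicator (fun _ => 2 * k * logSize M) U) := by
    intro U
    by_cases hU : U ∈ S
    · rw [Set.indicator_of_mem hU]
      have h1 := log_frobNorm_compound_le hM
        (X := stdIncl n k) (by rw [stdIncl_transpose_mul_self hkn]; simp)
      have h2 := (abs_le.1 (abs_gramLog_frame_le hkn hM U)).1
      have h3 : (k : ℝ) * posLog (frobNorm M) ≤ k * logSize M :=
        mul_le_mul_of_nonneg_left (le_add_of_nonneg_right (posLog_nonneg _)) (Nat.cast_nonneg k)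
      have := le_abs_self c₁
      have := abs_nonneg c₂
      have := abs_nonneg (Real.log δ)
      linarith
    · rw [Set.indicator_of_notMem hU]
      have hUlt : δ < |frameMinor f (K * U)| := not_le.1 hU
      have heq : ((K : Matrix (Fin n) (Fin n) ℝ) * ((U : Matrix (Fin n) (Fin n) ℝ) *
          stdIncl n k)).submatrix f id =
          (((K * U : Matrix.orthogonalGroup (Fin n) ℝ) : Matrix (Fin n) (Fin n) ℝ) *
            stdIncl n k).submatrix f id := by
        rw [Submonoid.coe_mul, Matrix.mul_assoc]
      have h1 := hK ((U : Matrix (Fin n) (Fin n) ℝ) * stdIncl n k)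
        (by rw [orthogonal_mul_stdIncl_gram hkn]; simp)
        (by rw [heq]; exact abs_pos.1 (hδ.trans hUlt))
      rw [heq, ← Matrix.mul_assoc] at h1
      have h2 : Real.log δ ≤ Real.log |frameMinor f (K * U)| := Real.log_le_log hδ hUlt.le
      unfold frameMinor at h2
      have := abs_nonneg c₁
      have := le_abs_self c₂
      have := neg_abs_le (Real.log δ)
      linarith
  have hind : Integrable (S.indicator fun _ : Matrix.orthogonalGroup (Fin n) ℝ =>
      2 * (k : ℝ) * logSize M) νO := (integrable_const _).indicator hmeasS
  have hfr := integrable_gramLog_frame νO hkn hM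
  have hint := integral_mono (integrable_const (Real.log (frobNorm (compound k M))))
    (hfr.add ((integrable_const D).add hind)) hpt
  have hup : Real.log (frobNorm (compound k M)) ≤
      avgGramLog νO k M + (D + νO.real S * (2 * k * logSize M)) := by
    have heq := integral_add hfr ((integrable_const D).add hind)
    have heq' := integral_add (integrable_const (μ := νO) D) hind
    rw [integral_indicator_const _ hmeasS] at heq'
    simp only [integral_const, probReal_univ, smul_eq_mul, one_mul, Pi.add_apply] at heq heq' hint
    rw [heq, heq'] at hint
    exact hint
  have hlast : νO.real S * (2 * k * logSize M) ≤ ε * logSize M := by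
    have h1 : νO.real S * (2 * k * logSize M) ≤ ε / (2 * k + 1) * (2 * k * logSize M) := by
      gcongr
    have h2 : ε / (2 * k + 1) * (2 * k * logSize M) ≤
        ε / (2 * k + 1) * ((2 * k + 1) * logSize M) := by
      gcongr
      linarith
    have h3 : ε / (2 * k + 1) * ((2 * k + 1) * logSize M) = ε * logSize M := by
      field_simp
    linarith
  have := le_abs_self (Real.log ((n : ℝ) ^ k))
  have := abs_nonneg (Real.log ((n : ℝ) ^ k))
  have := mul_nonneg hε.le hsize
  rw [abs_le]
  constructor <;> linarith

/-- The product `g_m ⋯ g₁` of the steps `ω = (g₁, …, g_m)`. -/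
def stepProd {n m : ℕ} (ω : Fin m → Matrix (Fin n) (Fin n) ℝ) : Matrix (Fin n) (Fin n) ℝ :=
  (List.ofFn ω).reverse.prod

theorem stepProd_zero {n : ℕ} (ω : Fin 0 → Matrix (Fin n) (Fin n) ℝ) : stepProd ω = 1 := by
  simp [stepProd]

theorem stepProd_succ {n m : ℕ} (ω : Fin (m + 1) → Matrix (Fin n) (Fin n) ℝ) :
    stepProd ω = stepProd (fun i => ω i.succ) * ω 0 := by
  simp [stepProd, List.ofFn_succ]

theorem continuous_stepProd (n m : ℕ) :
    Continuous (stepProd : (Fin m → Matrix (Fin n) (Fin n) ℝ) → Matrix (Fin n) (Fin n) ℝ) := by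
  induction m with
  | zero => simp only [funext stepProd_zero, continuous_const]
  | succ m ih =>
    rw [funext stepProd_succ]
    exact (ih.comp (by fun_prop)).matrix_mul (continuous_apply 0)

theorem isUnit_det_stepProd {n m : ℕ} {ω : Fin m → Matrix (Fin n) (Fin n) ℝ}
    (hω : ∀ i, IsUnit (ω i).det) : IsUnit (stepProd ω).det := by
  induction m with
  | zero => simp [stepProd_zero]
  | succ m ih =>
    rw [stepProd_succ, Matrix.det_mul]
    exact (ih fun i => hω i.succ).mul (hω 0)

theorem logSize_stepProd_le {n m : ℕ} (ω : Fin m → Matrix (Fin n) (Fin n) ℝ) :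
    logSize (stepProd ω) ≤ logSize (1 : Matrix (Fin n) (Fin n) ℝ) + ∑ i, logSize (ω i) := by
  induction m with
  | zero => simp [stepProd_zero]
  | succ m ih =>
    rw [stepProd_succ, Fin.sum_univ_succ]
    have h1 := logSize_mul_le (stepProd fun i => ω i.succ) (ω 0)
    have h2 := ih fun i => ω i.succ
    linarith

theorem avgGramLog_one {n : ℕ} [MeasurableSpace (Matrix.orthogonalGroup (Fin n) ℝ)]
    (νO : Measure (Matrix.orthogonalGroup (Fin n) ℝ)) {k : ℕ} (hkn : k ≤ n) :
    avgGramLog νO k 1 = 0 := by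
  unfold avgGramLog gramLog
  simp_rw [Matrix.one_mul, orthogonal_mul_stdIncl_gram hkn]
  simp

theorem continuous_frobNorm_compound (n k : ℕ) :
    Continuous fun M : Matrix (Fin n) (Fin n) ℝ => frobNorm (compound k M) := by
  unfold frobNorm compound
  fun_prop

section

variable {n : ℕ} [MeasurableSpace (Matrix (Fin n) (Fin n) ℝ)]
  (ν : Measure (Matrix (Fin n) (Fin n) ℝ)) [IsProbabilityMeasure ν]

theorem ae_isUnit_det_pi (hGL : ∀ᵐ A ∂ν, IsUnit A.det) (m : ℕ) :
    ∀ᵐ ω ∂(Measure.pi fun _ : Fin m => ν), ∀ i, IsUnit (ω i).det :=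
  eventually_all.2 fun i =>
    (measurePreserving_eval (fun _ : Fin m => ν) i).quasiMeasurePreserving.ae hGL

theorem integrable_sum_logSize (hint : Integrable logSize ν) (m : ℕ) :
    Integrable (fun ω : Fin m → Matrix (Fin n) (Fin n) ℝ => ∑ i, logSize (ω i))
      (Measure.pi fun _ : Fin m => ν) :=
  integrable_finsetSum _ fun i _ =>
    (measurePreserving_eval (fun _ : Fin m => ν) i).integrable_comp_of_integrable hint

theorem integral_sum_logSize (hint : Integrable logSize ν) (m : ℕ) :
    ∫ ω : Fin m → Matrix (Fin n) (Fin n) ℝ, ∑ i, logSize (ω i) ∂(Measure.pi fun _ : Fin m => ν) =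
      m * ∫ A, logSize A ∂ν := by
  have hmp := fun i => measurePreserving_eval (fun _ : Fin m => ν) i
  rw [integral_finsetSum (f := fun i (ω : Fin m → Matrix (Fin n) (Fin n) ℝ) => logSize (ω i)) _
    fun i _ => (hmp i).integrable_comp_of_integrable hint]
  have h : ∀ i : Fin m, ∫ ω : Fin m → Matrix (Fin n) (Fin n) ℝ, logSize (ω i)
      ∂(Measure.pi fun _ : Fin m => ν) = ∫ A, logSize A ∂ν := by
    intro i
    have h := integral_map (f := logSize) (hmp i).measurable.aemeasurable
      (by rw [(hmp i).map_eq]; exact hint.aestronglyMeasurable)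
    rw [(hmp i).map_eq] at h
    exact h.symm
  simp [h]

variable [BorelSpace (Matrix (Fin n) (Fin n) ℝ)]
  [MeasurableSpace (Matrix.orthogonalGroup (Fin n) ℝ)]
  [BorelSpace (Matrix.orthogonalGroup (Fin n) ℝ)]
  (νO : Measure (Matrix.orthogonalGroup (Fin n) ℝ)) [IsProbabilityMeasure νO]

theorem integrable_avgGramLog_stepProd (hGL : ∀ᵐ A ∂ν, IsUnit A.det)
    (hint : Integrable logSize ν) {k : ℕ} (hkn : k ≤ n) (m : ℕ) :
    Integrable (fun ω : Fin m → Matrix (Fin n) (Fin n) ℝ => avgGramLog νO k (stepProd ω))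
      (Measure.pi fun _ : Fin m => ν) := by
  have := secondCountableTopology_matrix n
  have hb : Integrable (fun ω : Fin m → Matrix (Fin n) (Fin n) ℝ =>
      gramLogConst n k + k * (logSize (1 : Matrix (Fin n) (Fin n) ℝ) + ∑ i, logSize (ω i)))
      (Measure.pi fun _ : Fin m => ν) :=
    (integrable_const _).add
      (((integrable_const _).add (integrable_sum_logSize ν hint m)).const_mul _)
  refine hb.mono' ((measurable_avgGramLog νO k).comp
    (continuous_stepProd n m).measurable).aestronglyMeasurable ?_
  filter_upwards [ae_isUnit_det_pi ν hGL m] with ω hω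
  refine (abs_avgGramLog_le νO hkn (isUnit_det_stepProd hω)).trans ?_
  have := logSize_stepProd_le ω
  gcongr

/-- The averaged distortion of a product of i.i.d. steps is additive in the number of steps. -/
theorem integral_avgGramLog_stepProd
    (hνO : ∀ U : Matrix.orthogonalGroup (Fin n) ℝ, νO.map (fun V => U * V) = νO)
    (hGL : ∀ᵐ A ∂ν, IsUnit A.det)
    (hOinv : ∀ U : Matrix.orthogonalGroup (Fin n) ℝ,
      ν.map (fun A => (U : Matrix (Fin n) (Fin n) ℝ) * A) = ν)
    (hint : Integrable logSize ν) {k : ℕ} (hkn : k ≤ n) (m : ℕ) :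
    ∫ ω : Fin m → Matrix (Fin n) (Fin n) ℝ, avgGramLog νO k (stepProd ω)
      ∂(Measure.pi fun _ : Fin m => ν) = m * ∫ A, avgGramLog νO k A ∂ν := by
  induction m with
  | zero => simp [stepProd_zero, avgGramLog_one νO hkn]
  | succ m ih =>
    set F : Matrix (Fin n) (Fin n) ℝ × (Fin m → Matrix (Fin n) (Fin n) ℝ) → ℝ :=
      fun p => avgGramLog νO k (stepProd p.2 * p.1) with hF
    have hmp := measurePreserving_piFinSuccAbove (fun _ : Fin (m + 1) => ν) 0
    have hcomp : ∀ ω : Fin (m + 1) → Matrix (Fin n) (Fin n) ℝ,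
        avgGramLog νO k (stepProd ω) =
          F (MeasurableEquiv.piFinSuccAbove (fun _ => Matrix (Fin n) (Fin n) ℝ) 0 ω) := by
      intro ω
      rw [stepProd_succ]
      rfl
    have hI := integrable_avgGramLog_stepProd ν νO hGL hint hkn (m + 1)
    simp_rw [hcomp] at hI ⊢
    have hFint : Integrable F (ν.prod (Measure.pi fun _ : Fin m => ν)) :=
      (hmp.integrable_comp_emb (MeasurableEquiv.measurableEmbedding _)).1 hI
    rw [hmp.integral_comp (MeasurableEquiv.measurableEmbedding _) F]
    calc ∫ p, F p ∂(ν.prod (Measure.pi fun _ : Fin m => ν))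
        = ∫ ω : Fin m → Matrix (Fin n) (Fin n) ℝ, ∫ A, avgGramLog νO k (stepProd ω * A) ∂ν
            ∂(Measure.pi fun _ : Fin m => ν) := integral_prod_symm F hFint
      _ = ∫ ω : Fin m → Matrix (Fin n) (Fin n) ℝ,
            (avgGramLog νO k (stepProd ω) + ∫ A, avgGramLog νO k A ∂ν)
            ∂(Measure.pi fun _ : Fin m => ν) := by
          refine integral_congr_ae ?_
          filter_upwards [ae_isUnit_det_pi ν hGL m] with ω hω
          exact integral_avgGramLog_mul νO hνO ν hGL hOinv hint hkn (isUnit_det_stepProd hω)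
      _ = _ := by
          rw [integral_add (integrable_avgGramLog_stepProd ν νO hGL hint hkn m)
            (integrable_const _), ih, integral_const]
          push_cast
          simp only [probReal_univ, one_smul]
          ring

theorem abs_integral_log_frobNorm_compound_sub_le
    (hνO : ∀ U : Matrix.orthogonalGroup (Fin n) ℝ, νO.map (fun V => U * V) = νO)
    (hGL : ∀ᵐ A ∂ν, IsUnit A.det)
    (hOinv : ∀ U : Matrix.orthogonalGroup (Fin n) ℝ,
      ν.map (fun A => (U : Matrix (Fin n) (Fin n) ℝ) * A) = ν)
    (hint : Integrable logSize ν) {k : ℕ} (hkn : k ≤ n) {ε : ℝ} (hε : 0 < ε) :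
    ∃ C : ℝ, ∀ m : ℕ, |∫ ω : Fin m → Matrix (Fin n) (Fin n) ℝ,
      Real.log (frobNorm (compound k (stepProd ω))) ∂(Measure.pi fun _ : Fin m => ν) -
        m * ∫ A, avgGramLog νO k A ∂ν| ≤ C + m * (ε * ∫ A, logSize A ∂ν) := by
  have := secondCountableTopology_matrix n
  obtain ⟨C, hC⟩ := exists_abs_log_frobNorm_compound_sub_le νO hνO hkn hε
  refine ⟨C + ε * logSize (1 : Matrix (Fin n) (Fin n) ℝ), fun m => ?_⟩
  set π := Measure.pi fun _ : Fin m => ν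
  have havg := integrable_avgGramLog_stepProd ν νO hGL hint hkn m
  have hsum := integrable_sum_logSize ν hint m
  have hb : Integrable (fun ω : Fin m → Matrix (Fin n) (Fin n) ℝ =>
      C + ε * logSize (1 : Matrix (Fin n) (Fin n) ℝ) + ε * ∑ i, logSize (ω i)) π :=
    (integrable_const _).add (hsum.const_mul _)
  have hpt : ∀ᵐ ω ∂π, ‖Real.log (frobNorm (compound k (stepProd ω))) -
      avgGramLog νO k (stepProd ω)‖ ≤
      C + ε * logSize (1 : Matrix (Fin n) (Fin n) ℝ) + ε * ∑ i, logSize (ω i) := by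
    filter_upwards [ae_isUnit_det_pi ν hGL m] with ω hω
    refine (hC _ (isUnit_det_stepProd hω)).trans ?_
    have := mul_le_mul_of_nonneg_left (logSize_stepProd_le ω) hε.le
    linarith
  have hmeas : Measurable fun ω : Fin m → Matrix (Fin n) (Fin n) ℝ =>
      Real.log (frobNorm (compound k (stepProd ω))) :=
    ((continuous_frobNorm_compound n k).comp (continuous_stepProd n m)).measurable.log
  have hdiff : Integrable (fun ω : Fin m → Matrix (Fin n) (Fin n) ℝ =>
      Real.log (frobNorm (compound k (stepProd ω))) - avgGramLog νO k (stepProd ω)) π :=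
    hb.mono' (hmeas.aestronglyMeasurable.sub havg.aestronglyMeasurable) hpt
  have hlog : Integrable (fun ω : Fin m → Matrix (Fin n) (Fin n) ℝ =>
      Real.log (frobNorm (compound k (stepProd ω)))) π :=
    (hdiff.add havg).congr (Eventually.of_forall fun ω => sub_add_cancel _ _)
  rw [← integral_avgGramLog_stepProd ν νO hνO hGL hOinv hint hkn m, ← integral_sub hlog havg]
  refine (norm_integral_le_of_norm_le hb hpt).trans (le_of_eq ?_)
  rw [integral_add (integrable_const _) (hsum.const_mul _), integral_const_mul,
    integral_sum_logSize ν hint m, integral_const]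
  simp only [probReal_univ, one_smul]
  ring

end

/-- Let `ν` be an `O(n)`-left-invariant probability measure on
`GL_n(ℝ)` with `log⁺‖A‖`, `log⁺‖A⁻¹‖` integrable, and let `r₁ ≥ ... ≥ r_n` be its
random Lyapunov exponents, characterized (Oseledets) by
`Σ_{i≤k} rᵢ = lim_m (1/m) E[log ‖Λ^k (g_m ⋯ g₁)‖]` for i.i.d. `gᵢ ∼ ν`.  Then for
each `1 ≤ k ≤ n`, `Σ_{i=1}^k rᵢ = ∫_{GL_n(ℝ)} ∫_{Gr(n,k)} log |det (A|_g)| dg dν(A)`,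
where the inner integral over the `O(n)`-invariant probability measure on
`Gr(n,k)` is written as an integral over `O(n)` (Haar) at `g = U g₀`, and
`|det (A|_g)| = √ det ((A U ι)ᵀ (A U ι))` with `ι = stdIncl n k`. -/
theorem sum_lyapunov_exponents_eq_integral_grassmannian
    (n : ℕ)
    [MeasurableSpace (Matrix (Fin n) (Fin n) ℝ)]
    [BorelSpace (Matrix (Fin n) (Fin n) ℝ)]
    (ν : Measure (Matrix (Fin n) (Fin n) ℝ)) [IsProbabilityMeasure ν]
    (hGL : ∀ᵐ A ∂ν, IsUnit A.det)
    (hOinv : ∀ U : Matrix.orthogonalGroup (Fin n) ℝ,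
      ν.map (fun A => (U : Matrix (Fin n) (Fin n) ℝ) * A) = ν)
    (hint₁ : Integrable (fun A => posLog (frobNorm A)) ν)
    (hint₂ : Integrable (fun A => posLog (frobNorm A⁻¹)) ν)
    (r : Fin n → ℝ) (hr : ∀ i j : Fin n, i ≤ j → r j ≤ r i)
    (hLyap : ∀ k : ℕ, 1 ≤ k → k ≤ n →
      Tendsto (fun m : ℕ =>
          (m : ℝ)⁻¹ * ∫ ω : Fin m → Matrix (Fin n) (Fin n) ℝ,
            Real.log (frobNorm (compound k ((List.ofFn ω).reverse.prod)))
            ∂(Measure.pi fun _ : Fin m => ν))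
        atTop
        (nhds (∑ i ∈ Finset.univ.filter (fun i : Fin n => (i : ℕ) < k), r i)))
    -- normalized Haar measure on `O(n)`:
    [MeasurableSpace (Matrix.orthogonalGroup (Fin n) ℝ)]
    [BorelSpace (Matrix.orthogonalGroup (Fin n) ℝ)]
    (νO : Measure (Matrix.orthogonalGroup (Fin n) ℝ)) [IsProbabilityMeasure νO]
    (hνO : ∀ U : Matrix.orthogonalGroup (Fin n) ℝ, νO.map (fun V => U * V) = νO)
    (k : ℕ) (hk1 : 1 ≤ k) (hkn : k ≤ n) :
    (∑ i ∈ Finset.univ.filter (fun i : Fin n => (i : ℕ) < k), r i)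
      = ∫ A : Matrix (Fin n) (Fin n) ℝ,
          (∫ U : Matrix.orthogonalGroup (Fin n) ℝ,
            Real.log (Real.sqrt
              (((A * (U : Matrix (Fin n) (Fin n) ℝ) * stdIncl n k)ᵀ
                * (A * (U : Matrix (Fin n) (Fin n) ℝ) * stdIncl n k)).det)) ∂νO) ∂ν := by
  have hint : Integrable logSize ν := hint₁.add hint₂
  set I := ∫ A, avgGramLog νO k A ∂ν with hI
  set S := ∑ i ∈ Finset.univ.filter (fun i : Fin n => (i : ℕ) < k), r i with hS
  set E := ∫ A, logSize A ∂ν with hE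
  have hE0 : 0 ≤ E := integral_nonneg logSize_nonneg
  change S = I
  have hlim := hLyap k hk1 hkn
  have hle : ∀ ε : ℝ, 0 < ε → |S - I| ≤ ε * E := by
    intro ε hε
    obtain ⟨C, hC⟩ := abs_integral_log_frobNorm_compound_sub_le ν νO hνO hGL hOinv hint hkn hε
    have hright : Tendsto (fun m : ℕ => (m : ℝ)⁻¹ * C + ε * E) atTop (nhds (0 * C + ε * E)) :=
      (tendsto_inv_atTop_nhds_zero_nat.mul_const C).add_const _
    rw [zero_mul, zero_add] at hright
    refine le_of_tendsto_of_tendsto (hlim.sub_const I).abs hright ?_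
    filter_upwards [eventually_gt_atTop 0] with m hm
    have hm' : (0 : ℝ) < m := Nat.cast_pos.2 hm
    have h := mul_le_mul_of_nonneg_left (hC m) (inv_nonneg.2 hm'.le)
    rw [← abs_of_nonneg (inv_nonneg.2 hm'.le), ← abs_mul, abs_of_nonneg (inv_nonneg.2 hm'.le),
      mul_sub, inv_mul_cancel_left₀ hm'.ne', mul_add, inv_mul_cancel_left₀ hm'.ne'] at h
    exact h
  have hzero : |S - I| ≤ 0 := by
    refine le_of_forall_pos_le_add fun η hη => ?_
    have h := hle (η / (E + 1)) (by positivity)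
    have h' : η / (E + 1) * E ≤ η := by
      rw [div_mul_eq_mul_div, div_le_iff₀ (by positivity)]
      nlinarith
    linarith
  exact sub_eq_zero.1 (abs_nonpos_iff.1 hzero)

end
end
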